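/- arXiv:2303.11310 — 17 statements merged into one kernel-verified Lean document; each statement's English description precedes it below -/
import Mathlib

section
/- Fix reals λ_s > 0, λ > 0 and integers n ≥ n_0 ≥ 1, and let Δ be a line-network age family on n_0 nodes. Then for every integer i with 1 ≤ i, i + 1 ≤ n_0 and 2i ≤ n_0, the single-node ages satisfy Δ(i+1, 1) ≤ Δ(i, 1); that is, in a line network the expected version age is highest at the corner nodes and decreases towards the center. -/
/-- In a line network of `n0` nodes (source self-update rate `lamS`,
source-to-node rate `lam/n`, node-to-neighbor rate `lam/2`), the expected version age is
highest at the corner nodes and decreases towards the center: `Δ(i+1,1) ≤ Δ(i,1)` for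
`2i ≤ n0`.  Here `Δ j k` is the long-term expected version age of the contiguous node set
`{j, …, j+k-1}`, characterized by the Yates recursion together with set-monotonicity. -/
theorem line_age_decreases_towards_center
    (lamS lam : ℝ) (hlamS : 0 < lamS) (hlam : 0 < lam)
    (n n0 : ℕ) (hn0 : 1 ≤ n0) (hn : n0 ≤ n)
    (Δ : ℕ → ℕ → ℝ)
    (hfull : Δ 1 n0 = lamS * n / (n0 * lam))
    (hleft : ∀ k : ℕ, 1 ≤ k → k < n0 →
      Δ 1 k = (lamS + (lam / 2) * Δ 1 (k + 1)) / ((k : ℝ) * lam / n + lam / 2))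
    (hright : ∀ j k : ℕ, 1 ≤ k → k < n0 → 1 < j → j + k - 1 = n0 →
      Δ j k = (lamS + (lam / 2) * Δ (j - 1) (k + 1)) / ((k : ℝ) * lam / n + lam / 2))
    (hmid : ∀ j k : ℕ, 1 ≤ k → k < n0 → 1 < j → j + k - 1 < n0 →
      Δ j k = (lamS + (lam / 2) * Δ j (k + 1) + (lam / 2) * Δ (j - 1) (k + 1)) /
        ((k : ℝ) * lam / n + lam))
    (hmono : ∀ j k j' k' : ℕ, 1 ≤ j → 1 ≤ k → 1 ≤ j' → 1 ≤ k' →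
      j + k - 1 ≤ n0 → j' + k' - 1 ≤ n0 →
      j' ≤ j → j + k ≤ j' + k' → Δ j' k' ≤ Δ j k)
    (i : ℕ) (hi : 1 ≤ i) (hi1 : i + 1 ≤ n0) (h2i : 2 * i ≤ n0) :
    Δ (i + 1) 1 ≤ Δ i 1 := by
  have hnpos : (0 : ℝ) < n := by exact_mod_cast (by omega : 0 < n)
  -- Reflecting the line preserves the age.
  have symm : ∀ m k j j' : ℕ, k + m = n0 → 1 ≤ k → 1 ≤ j → 1 ≤ j' → j + j' + k = n0 + 2 →
      Δ j k = Δ j' k := by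
    intro m
    induction m with
    | zero =>
      intro k j j' hk _ hj hj' hs
      obtain rfl : j = j' := by omega
      rfl
    | succ m ih =>
      intro k j j' hk hk1 hj hj' hs
      rcases Nat.eq_or_lt_of_le hj with rfl | hj1
      · rw [hleft k hk1 (by omega), hright j' k hk1 (by omega) (by omega) (by omega),
          ih (k + 1) 1 (j' - 1) (by omega) (by omega) (by omega) (by omega) (by omega)]
      · rcases Nat.eq_or_lt_of_le hj' with rfl | hj1'
        · rw [hleft k hk1 (by omega), hright j k hk1 (by omega) (by omega) (by omega),
            ih (k + 1) 1 (j - 1) (by omega) (by omega) (by omega) (by omega) (by omega)]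
        · rw [hmid j k hk1 (by omega) hj1 (by omega), hmid j' k hk1 (by omega) hj1' (by omega),
            ih (k + 1) j (j' - 1) (by omega) (by omega) (by omega) (by omega) (by omega),
            ih (k + 1) (j - 1) j' (by omega) (by omega) (by omega) (by omega) (by omega)]
          ring
  -- Shifting a set towards the center does not increase its age.
  have shift : ∀ m k j : ℕ, k + m = n0 → 1 ≤ k → 1 ≤ j → 2 * j + k ≤ n0 + 1 →
      Δ (j + 1) k ≤ Δ j k := by
    intro m
    induction m with
    | zero => intro k j hk _ hj hs; omega
    | succ m ih =>
      intro k j hk hk1 hj hs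
      rcases Nat.eq_or_lt_of_le hs with he | hs'
      · exact (symm (m + 1) k (j + 1) j hk hk1 (by omega) hj (by omega)).le
      have hstep := ih (k + 1) j (by omega) (by omega) hj (by omega)
      have ha : 0 < (k : ℝ) * lam / n := by positivity
      rcases Nat.eq_or_lt_of_le hj with rfl | hj1
      · have hle := hmono 1 k 1 (k + 1) le_rfl hk1 le_rfl (by omega) (by omega) (by omega)
          le_rfl (by omega)
        have h1 := hleft k hk1 (by omega)
        have h2 := hmid (1 + 1) k hk1 (by omega) (by omega) (by omega)
        rw [eq_div_iff (by positivity)] at h1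
        rw [h2, div_le_iff₀ (by positivity)]
        simp only [Nat.add_sub_cancel]
        have := mul_le_mul_of_nonneg_left (hstep.trans hle) (half_pos hlam).le
        linarith
      · have hprev := ih (k + 1) (j - 1) (by omega) (by omega) (by omega) (by omega)
        rw [Nat.sub_add_cancel hj] at hprev
        rw [hmid (j + 1) k hk1 (by omega) (by omega) (by omega),
          hmid j k hk1 (by omega) hj1 (by omega), Nat.add_sub_cancel]
        gcongr
  exact shift (n0 - 1) 1 i (by omega) le_rfl hi (by omega)
end

section
/- Fix reals λ_s > 0, λ > 0 and integers n ≥ n_0 ≥ 1, and let δ be the symmetric ring age sequence on n_0 nodes. Then δ(1) = (λ_s/λ)·( Σ_{j=1}^{n_0−1} Π_{k=1}^{j} 1/(k/n + 1) + (n/n_0)·Π_{k=1}^{n_0−1} 1/(k/n + 1) ), where empty sums are 0 and empty products are 1. -/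
/-- Unrolling `m` steps of the recursion `x k = (c + x (k + 1)) * a k` starting at `k = 1`. -/
theorem eq_sum_prod_add_prod_mul_of_affine_rec {R : Type*} [CommSemiring R]
    (c : R) (a x : ℕ → R) (m : ℕ)
    (h : ∀ k, 1 ≤ k → k ≤ m → x k = (c + x (k + 1)) * a k) :
    x 1 = c * ∑ j ∈ Finset.Icc 1 m, ∏ k ∈ Finset.Icc 1 j, a k
      + (∏ k ∈ Finset.Icc 1 m, a k) * x (m + 1) := by
  induction m with
  | zero => simp
  | succ m ih =>
    rw [ih fun k h1 hk => h k h1 (by lia), h (m + 1) (by lia) le_rfl,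
      Finset.sum_Icc_succ_top (by lia), Finset.prod_Icc_succ_top (by lia)]
    ring

/-- Closed-form expression for the per-node version age of a symmetric
ring network of `n0` nodes: the symmetric ring age sequence `δ` (with `δ k` the age of a
set of `k` contiguous nodes), defined by the downward recursion
`δ n0 = lamS·n/(n0·lam)` and `δ k = (lamS + lam·δ(k+1))/(k·lam/n + lam)` for `1 ≤ k < n0`,
satisfies
`δ 1 = (lamS/lam)·( Σ_{j=1}^{n0-1} Π_{k=1}^{j} 1/(k/n+1) + (n/n0)·Π_{k=1}^{n0-1} 1/(k/n+1) )`. -/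
theorem ring_age_closed_form
    (lamS lam : ℝ) (hlamS : 0 < lamS) (hlam : 0 < lam)
    (n n0 : ℕ) (hn0 : 1 ≤ n0) (hn : n0 ≤ n)
    (δ : ℕ → ℝ)
    (hend : δ n0 = lamS * n / (n0 * lam))
    (hrec : ∀ k : ℕ, 1 ≤ k → k < n0 →
      δ k = (lamS + lam * δ (k + 1)) / ((k : ℝ) * lam / n + lam)) :
    δ 1 = (lamS / lam) *
      ((∑ j ∈ Finset.Icc 1 (n0 - 1), ∏ k ∈ Finset.Icc 1 j, (1 / ((k : ℝ) / n + 1)))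
        + ((n : ℝ) / n0) * ∏ k ∈ Finset.Icc 1 (n0 - 1), (1 / ((k : ℝ) / n + 1))) := by
  have hrec' : ∀ k : ℕ, 1 ≤ k → k ≤ n0 - 1 →
      δ k = (lamS / lam + δ (k + 1)) * (1 / ((k : ℝ) / n + 1)) := by
    intro k h1 hk
    have hpos : (k : ℝ) / n + 1 ≠ 0 := by positivity
    have hden : (k : ℝ) * lam / n + lam = lam * ((k : ℝ) / n + 1) := by ring
    rw [hrec k h1 (by lia), hden]
    field_simp
  rw [eq_sum_prod_add_prod_mul_of_affine_rec (lamS / lam)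
    (fun k : ℕ => 1 / ((k : ℝ) / n + 1)) δ (n0 - 1) hrec', Nat.sub_add_cancel hn0, hend]
  ring
end

section
/- Fix reals λ_s > 0, λ > 0 and integers n ≥ n_0 ≥ 1. Let Δ be a line-network age family on n_0 nodes and let δ be the symmetric ring age sequence on n_0 nodes. Then for every integer i with 1 ≤ i ≤ n_0, the single-node line ages are sandwiched as δ(1) ≤ Δ(i, 1) ≤ 2·δ(1); that is, the version age of each node of a line network lies between the per-node version age of a ring network of the same size and twice that quantity. -/
/-- The version age of each node of a line network of `n0` nodes is
sandwiched between the per-node version age of a ring network of the same size and twice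
that quantity: `δ 1 ≤ Δ(i,1) ≤ 2·δ 1` for every node `i`.  Here `Δ` is a line-network age
family (Yates recursion plus set-monotonicity) and `δ` is the symmetric ring age sequence. -/
theorem line_age_sandwiched_by_ring_age
    (lamS lam : ℝ) (hlamS : 0 < lamS) (hlam : 0 < lam)
    (n n0 : ℕ) (hn0 : 1 ≤ n0) (hn : n0 ≤ n)
    (Δ : ℕ → ℕ → ℝ)
    (hfull : Δ 1 n0 = lamS * n / (n0 * lam))
    (hleft : ∀ k : ℕ, 1 ≤ k → k < n0 →
      Δ 1 k = (lamS + (lam / 2) * Δ 1 (k + 1)) / ((k : ℝ) * lam / n + lam / 2))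
    (hright : ∀ j k : ℕ, 1 ≤ k → k < n0 → 1 < j → j + k - 1 = n0 →
      Δ j k = (lamS + (lam / 2) * Δ (j - 1) (k + 1)) / ((k : ℝ) * lam / n + lam / 2))
    (hmid : ∀ j k : ℕ, 1 ≤ k → k < n0 → 1 < j → j + k - 1 < n0 →
      Δ j k = (lamS + (lam / 2) * Δ j (k + 1) + (lam / 2) * Δ (j - 1) (k + 1)) /
        ((k : ℝ) * lam / n + lam))
    (hmono : ∀ j k j' k' : ℕ, 1 ≤ j → 1 ≤ k → 1 ≤ j' → 1 ≤ k' →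
      j + k - 1 ≤ n0 → j' + k' - 1 ≤ n0 →
      j' ≤ j → j + k ≤ j' + k' → Δ j' k' ≤ Δ j k)
    (δ : ℕ → ℝ)
    (hend : δ n0 = lamS * n / (n0 * lam))
    (hrec : ∀ k : ℕ, 1 ≤ k → k < n0 →
      δ k = (lamS + lam * δ (k + 1)) / ((k : ℝ) * lam / n + lam))
    (i : ℕ) (hi : 1 ≤ i) (hin0 : i ≤ n0) :
    δ 1 ≤ Δ i 1 ∧ Δ i 1 ≤ 2 * δ 1 := by
  suffices key : ∀ k, k ≤ n0 → 1 ≤ k →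
      0 ≤ δ k ∧ ∀ j, 1 ≤ j → j + k - 1 ≤ n0 → δ k ≤ Δ j k ∧ Δ j k ≤ 2 * δ k from
    (key 1 hn0 le_rfl).2 i hi (by omega)
  intro k hk
  induction hk using Nat.decreasingInduction with
  | self =>
    intro _
    have h0 : 0 ≤ δ n0 := by rw [hend]; positivity
    refine ⟨h0, fun j hj hjk => ?_⟩
    obtain rfl : j = 1 := by omega
    have h : Δ 1 n0 = δ n0 := hfull.trans hend.symm
    constructor <;> linarith
  | of_succ k hk ih =>
    intro hk1
    obtain ⟨h0, hbound⟩ := ih (by omega)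
    have hδ := hrec k hk1 hk
    have hc : (0 : ℝ) ≤ (k : ℝ) * lam / n := by positivity
    have hL := hleft k hk1 hk
    have hright' := fun j => hright j k hk1 hk
    have hmid' := fun j => hmid j k hk1 hk
    generalize (k : ℝ) * lam / n = c at hc hδ hL hright' hmid'
    have hδ0 : 0 ≤ δ k := by rw [hδ]; positivity
    rw [eq_div_iff (by positivity)] at hδ hL
    refine ⟨hδ0, fun j hj hjk => ?_⟩
    -- At either end of the line the age obeys a one-neighbor recursion.
    have hboundary : ∀ x y : ℝ, x * (c + lam / 2) = lamS + lam / 2 * y → y ≤ x →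
        δ (k + 1) ≤ y → y ≤ 2 * δ (k + 1) → δ k ≤ x ∧ x ≤ 2 * δ k := by
      intro x y hxy hyx hly hyu
      constructor
      · refine le_of_mul_le_mul_right (a := c + lam) ?_ (by positivity)
        nlinarith
      · refine le_of_mul_le_mul_right (a := c + lam / 2) ?_ (by positivity)
        nlinarith [mul_nonneg hδ0 hc]
    obtain rfl | hj1 := hj.eq_or_lt
    · obtain ⟨hl, hu⟩ := hbound 1 le_rfl (by omega)
      exact hboundary _ _ hL (hmono 1 k 1 (k + 1) le_rfl hk1 le_rfl (by omega)
        (by omega) (by omega) le_rfl (by omega)) hl hu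
    obtain ⟨hl, hu⟩ := hbound (j - 1) (by omega) (by omega)
    obtain hend_right | hinner := hjk.eq_or_lt
    · have hR := hright' j hj1 hend_right
      rw [eq_div_iff (by positivity)] at hR
      exact hboundary _ _ hR (hmono j k (j - 1) (k + 1) hj hk1 (by omega) (by omega)
        hjk (by omega) (by omega) (by omega)) hl hu
    · obtain ⟨hl', hu'⟩ := hbound j hj (by omega)
      have hM := hmid' j hj1 hinner
      rw [eq_div_iff (by positivity)] at hM
      constructor <;> refine le_of_mul_le_mul_right (a := c + lam) ?_ (by positivity) <;>
        nlinarith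
end

section
/- Fix reals λ_s > 0, λ > 0 and a positive integer n. For every positive integer m, the total ring ages satisfy g(m+1) − g(m) = (λ_s/λ)·Σ_{j=1}^{m} Π_{k=1}^{j} 1/(k/n + 1), and consequently the difference g(m) − g(m+1) is strictly decreasing in m: for all positive integers m, g(m+1) − g(m+2) < g(m) − g(m+1). -/
/-- Per-node long-term expected version age `D(m)` of an `m`-node mini-ring
(source self-update rate `lamS`, source-to-node rate `lam/n`, neighbor rate `lam/2`). -/
noncomputable def ringAge (lamS lam : ℝ) (n m : ℕ) : ℝ :=
  (lamS / lam) *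
    ((∑ j ∈ Finset.Icc 1 (m - 1), ∏ k ∈ Finset.Icc 1 j, (1 / ((k : ℝ) / n + 1)))
      + ((n : ℝ) / m) * ∏ k ∈ Finset.Icc 1 (m - 1), (1 / ((k : ℝ) / n + 1)))

/-- Total age `g(m) = m·D(m)` of an `m`-node mini-ring. -/
noncomputable def totalRingAge (lamS lam : ℝ) (n m : ℕ) : ℝ :=
  (m : ℝ) * ringAge lamS lam n m

/-- The total ring age with the factor `m` and the division by `m` cancelled. -/
theorem totalRingAge_succ (lamS lam : ℝ) (n p : ℕ) :
    totalRingAge lamS lam n (p + 1) = (lamS / lam) *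
      ((p + 1 : ℝ) * (∑ j ∈ Finset.Icc 1 p, ∏ k ∈ Finset.Icc 1 j, (1 / ((k : ℝ) / n + 1)))
        + n * ∏ k ∈ Finset.Icc 1 p, (1 / ((k : ℝ) / n + 1))) := by
  have hp : (p + 1 : ℝ) ≠ 0 := by positivity
  simp only [totalRingAge, ringAge, Nat.add_sub_cancel]
  push_cast
  field_simp

theorem totalRingAge_succ_sub (lamS lam : ℝ) {n m : ℕ} (hn : 0 < n) (hm : 1 ≤ m) :
    totalRingAge lamS lam n (m + 1) - totalRingAge lamS lam n m
      = (lamS / lam) *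
        ∑ j ∈ Finset.Icc 1 m, ∏ k ∈ Finset.Icc 1 j, (1 / ((k : ℝ) / n + 1)) := by
  obtain ⟨p, rfl⟩ := Nat.exists_eq_add_of_le' hm
  have hn' : (0 : ℝ) < n := by exact_mod_cast hn
  have hprod := Finset.prod_Icc_succ_top (Nat.le_add_left 1 p)
    (fun k : ℕ => 1 / ((k : ℝ) / n + 1))
  have hstep : (p + 1 + n : ℝ) * ∏ k ∈ Finset.Icc 1 (p + 1), (1 / ((k : ℝ) / n + 1))
      = n * ∏ k ∈ Finset.Icc 1 p, (1 / ((k : ℝ) / n + 1)) := by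
    rw [hprod]
    have h : (p + 1 + n : ℝ) * (1 / (((p + 1 : ℕ) : ℝ) / n + 1)) = n := by
      push_cast
      field_simp
    linear_combination (∏ k ∈ Finset.Icc 1 p, (1 / ((k : ℝ) / n + 1))) * h
  rw [totalRingAge_succ, totalRingAge_succ, Finset.sum_Icc_succ_top (Nat.le_add_left 1 p)]
  push_cast
  linear_combination (lamS / lam) * hstep

/-- For every positive integer `m`,
`g(m+1) − g(m) = (lamS/lam)·Σ_{j=1}^{m} Π_{k=1}^{j} 1/(k/n+1)`, and consequently the
difference `g(m) − g(m+1)` is strictly decreasing in `m`. -/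
theorem totalRingAge_difference
    (lamS lam : ℝ) (hlamS : 0 < lamS) (hlam : 0 < lam)
    (n : ℕ) (hn : 0 < n) :
    (∀ m : ℕ, 1 ≤ m →
      totalRingAge lamS lam n (m + 1) - totalRingAge lamS lam n m
        = (lamS / lam) * ∑ j ∈ Finset.Icc 1 m, ∏ k ∈ Finset.Icc 1 j, (1 / ((k : ℝ) / n + 1)))
    ∧ (∀ m : ℕ, 1 ≤ m →
      totalRingAge lamS lam n (m + 1) - totalRingAge lamS lam n (m + 2)
        < totalRingAge lamS lam n m - totalRingAge lamS lam n (m + 1)) := by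
  refine ⟨fun m hm => totalRingAge_succ_sub lamS lam hn hm, fun m hm => ?_⟩
  have h₁ := totalRingAge_succ_sub lamS lam hn hm
  have h₂ := totalRingAge_succ_sub lamS lam hn (Nat.le_add_left 1 m)
  rw [Finset.sum_Icc_succ_top (Nat.le_add_left 1 m), mul_add] at h₂
  have hpos : 0 < (lamS / lam) * ∏ k ∈ Finset.Icc 1 (m + 1), (1 / ((k : ℝ) / n + 1)) :=
    mul_pos (div_pos hlamS hlam) (Finset.prod_pos fun k _ => by positivity)
  linarith
end

section
/- For all positive integers n and j with 1 ≤ j ≤ n, the product Π_{k=1}^{j} 1/(1 + k/n) satisfies exp(−j²/n) ≤ Π_{k=1}^{j} 1/(1 + k/n) ≤ exp(−j²/(4n)). -/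
lemma Real.exp_half_le_one_add {x : ℝ} (hx0 : 0 ≤ x) (hx1 : x ≤ 1) :
    Real.exp (x / 2) ≤ 1 + x := by
  have h : 1 - x / 2 ≤ Real.exp (-(x / 2)) := Real.one_sub_le_exp_neg _
  have hpos : 0 < Real.exp (x / 2) := Real.exp_pos _
  have hmul : Real.exp (x / 2) * (1 - x / 2) ≤ 1 := by
    calc Real.exp (x / 2) * (1 - x / 2) ≤ Real.exp (x / 2) * Real.exp (-(x / 2)) := by gcongr
      _ = 1 := by rw [← Real.exp_add, add_neg_cancel, Real.exp_zero]
  have hone : 1 ≤ (1 + x) * (1 - x / 2) := by nlinarith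
  exact le_of_mul_le_mul_right (hmul.trans hone) (by linarith)

lemma Real.exp_neg_mul_sq_eq_prod (c : ℝ) (j : ℕ) :
    Real.exp (-(c * (j : ℝ) ^ 2)) =
      ∏ k ∈ Finset.Icc 1 j, Real.exp (-(c * (2 * (k : ℝ) - 1))) := by
  induction j with
  | zero => simp
  | succ j ih =>
    rw [Finset.prod_Icc_succ_top (by omega), ← ih, ← Real.exp_add]
    congr 1
    push_cast
    ring

/-- For all positive integers `n` and `j` with `1 ≤ j ≤ n`,
`exp(−j²/n) ≤ Π_{k=1}^{j} 1/(1 + k/n) ≤ exp(−j²/(4n))`. -/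
theorem prod_one_div_one_add_bounds
    (n j : ℕ) (hj : 1 ≤ j) (hjn : j ≤ n) :
    Real.exp (-(j : ℝ) ^ 2 / n) ≤ (∏ k ∈ Finset.Icc 1 j, (1 / (1 + (k : ℝ) / n))) ∧
      (∏ k ∈ Finset.Icc 1 j, (1 / (1 + (k : ℝ) / n))) ≤ Real.exp (-(j : ℝ) ^ 2 / (4 * n)) := by
  have hn : (0 : ℝ) < n := by exact_mod_cast hj.trans hjn
  constructor
  · rw [show -(j : ℝ) ^ 2 / n = -(1 / n * (j : ℝ) ^ 2) by ring, Real.exp_neg_mul_sq_eq_prod]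
    refine Finset.prod_le_prod (fun k _ => (Real.exp_pos _).le) fun k hk => ?_
    have hk1 : (1 : ℝ) ≤ k := by exact_mod_cast (Finset.mem_Icc.mp hk).1
    rw [Real.exp_neg, ← one_div]
    refine one_div_le_one_div_of_le (by positivity) ?_
    calc 1 + (k : ℝ) / n ≤ Real.exp (k / n) := by
          rw [add_comm]
          exact Real.add_one_le_exp _
      _ ≤ Real.exp (1 / n * (2 * k - 1)) := by
          rw [Real.exp_le_exp, one_div_mul_eq_div]
          gcongr
          linarith
  · rw [show -(j : ℝ) ^ 2 / (4 * n) = -(1 / (4 * n) * (j : ℝ) ^ 2) by ring,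
      Real.exp_neg_mul_sq_eq_prod]
    refine Finset.prod_le_prod (fun k _ => by positivity) fun k hk => ?_
    have hkn : (k : ℝ) ≤ n := by exact_mod_cast (Finset.mem_Icc.mp hk).2.trans hjn
    rw [Real.exp_neg, ← one_div]
    refine one_div_le_one_div_of_le (Real.exp_pos _) ?_
    calc Real.exp (1 / (4 * n) * (2 * k - 1)) ≤ Real.exp (k / n / 2) := by
          rw [Real.exp_le_exp, one_div_mul_eq_div,
            show (k : ℝ) / n / 2 = 2 * k / (4 * n) by ring]
          gcongr
          linarith
      _ ≤ 1 + (k : ℝ) / n :=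
          Real.exp_half_le_one_add (by positivity) ((div_le_one hn).mpr hkn)
end

section
/- There exists a constant C > 0 such that for all positive integers n and n_0 with n_0 ≤ n, the sum Σ_{j=1}^{n_0} Π_{k=1}^{j} 1/(k/n + 1) ≤ C·√n. -/
open Finset in
/-- A telescoping identity: with `P j = ∏ k ∈ Icc 1 j, 1 / (k / x + 1)`, each term `j * P j` equals
`x * (P (j - 1) - P j)`. -/
theorem sum_mul_prod_one_div_add_one {x : ℝ} (hx : 0 < x) (m : ℕ) :
    ∑ j ∈ Icc 1 m, (j : ℝ) * ∏ k ∈ Icc 1 j, (1 / ((k : ℝ) / x + 1)) =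
      x * (1 - ∏ k ∈ Icc 1 m, (1 / ((k : ℝ) / x + 1))) := by
  induction m with
  | zero => simp
  | succ m ih =>
    rw [sum_Icc_succ_top (by lia), ih, prod_Icc_succ_top (by lia)]
    have h : ((m + 1 : ℕ) : ℝ) / x + 1 ≠ 0 := by positivity
    have h' : (x + (m + 1 : ℕ) : ℝ) ≠ 0 := by positivity
    field_simp
    ring

open Finset in
theorem sum_Icc_ite_le {s : ℝ} (hs : 0 ≤ s) (m : ℕ) :
    ∑ j ∈ Icc 1 m, (if (j : ℝ) ≤ s then (1 : ℝ) else 0) ≤ s := by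
  rw [sum_boole]
  have hsub : (Icc 1 m).filter (fun j : ℕ => (j : ℝ) ≤ s) ⊆ Icc 1 ⌊s⌋₊ := by
    intro j hj
    simp only [mem_filter, mem_Icc] at hj ⊢
    exact ⟨hj.1.1, Nat.le_floor hj.2⟩
  have hcard := card_le_card hsub
  rw [Nat.card_Icc, Nat.add_sub_cancel] at hcard
  exact (Nat.cast_le.mpr hcard).trans (Nat.floor_le hs)


/-- There exists a constant `C > 0` such that for all positive integers
`n` and `n0` with `n0 ≤ n`,
`Σ_{j=1}^{n0} Π_{k=1}^{j} 1/(k/n + 1) ≤ C·√n`. -/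
theorem sum_prod_le_sqrt :
    ∃ C : ℝ, 0 < C ∧ ∀ n n0 : ℕ, 0 < n → 0 < n0 → n0 ≤ n →
      (∑ j ∈ Finset.Icc 1 n0, ∏ k ∈ Finset.Icc 1 j, (1 / ((k : ℝ) / n + 1)))
        ≤ C * Real.sqrt n := by
  refine ⟨2, two_pos, fun n n0 hn _ _ => ?_⟩
  have hx : (0 : ℝ) < n := Nat.cast_pos.mpr hn
  have hs : 0 < √(n : ℝ) := Real.sqrt_pos.mpr hx
  set P : ℕ → ℝ := fun j => ∏ k ∈ Finset.Icc 1 j, (1 / ((k : ℝ) / n + 1))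
  have hP0 (j : ℕ) : 0 ≤ P j := Finset.prod_nonneg fun k _ => by positivity
  have hP1 (j : ℕ) : P j ≤ 1 := Finset.prod_le_one (fun k _ => by positivity) fun k _ =>
    div_le_one_of_le₀ (le_add_of_nonneg_left (by positivity)) (by positivity)
  have hle (j : ℕ) : P j ≤ (if (j : ℝ) ≤ √n then 1 else 0) + j * P j / √n := by
    split_ifs with hj
    · exact (hP1 j).trans (le_add_of_nonneg_right (by have := hP0 j; positivity))
    · rw [zero_add, le_div_iff₀ hs, mul_comm]
      exact mul_le_mul_of_nonneg_right (not_le.mp hj).le (hP0 j)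
  have hweighted : ∑ j ∈ Finset.Icc 1 n0, (j : ℝ) * P j ≤ n := by
    rw [sum_mul_prod_one_div_add_one hx]
    exact mul_le_of_le_one_right hx.le (sub_le_self _ (hP0 n0))
  calc ∑ j ∈ Finset.Icc 1 n0, P j
      ≤ ∑ j ∈ Finset.Icc 1 n0, ((if (j : ℝ) ≤ √n then 1 else 0) + j * P j / √n) :=
        Finset.sum_le_sum fun j _ => hle j
    _ = ∑ j ∈ Finset.Icc 1 n0, (if (j : ℝ) ≤ √n then 1 else 0) +
          (∑ j ∈ Finset.Icc 1 n0, (j : ℝ) * P j) / √n := by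
        rw [Finset.sum_add_distrib, Finset.sum_div]
    _ ≤ √n + n / √n := by
        gcongr
        exact sum_Icc_ite_le hs.le n0
    _ = 2 * √n := by rw [Real.div_sqrt, two_mul]
end

section
/- There exist a constant c' > 0 and a positive integer N such that for all integers n ≥ N and all integers n_0 with √n ≤ n_0 ≤ n, the sum Σ_{j=1}^{n_0} Π_{k=1}^{j} 1/(k/n + 1) ≥ c'·√n. -/
/-- As long as `j ^ 2 ≤ n`, the product `∏_{k=1}^{j} 1/(k/n + 1)` is bounded below by `e⁻¹`. -/
theorem exp_neg_one_le_prod_one_div {n j : ℕ} (hj : j * j ≤ n) :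
    Real.exp (-1) ≤ ∏ k ∈ Finset.Icc 1 j, (1 / ((k : ℝ) / n + 1)) := by
  have hfactor : ∀ k ∈ Finset.Icc 1 j,
      Real.exp (-((j : ℝ) / n)) ≤ 1 / ((k : ℝ) / n + 1) := by
    intro k hk
    have hkj : (k : ℝ) ≤ j := by exact_mod_cast (Finset.mem_Icc.mp hk).2
    rw [Real.exp_neg, ← one_div]
    refine one_div_le_one_div_of_le (by positivity) ?_
    calc (k : ℝ) / n + 1 ≤ (j : ℝ) / n + 1 := by gcongr
      _ ≤ Real.exp ((j : ℝ) / n) := Real.add_one_le_exp _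
  have hexponent : (j : ℝ) * ((j : ℝ) / n) ≤ 1 := by
    rw [← mul_div_assoc]
    exact div_le_one_of_le₀ (by exact_mod_cast hj) (by positivity)
  calc Real.exp (-1) ≤ Real.exp ((j : ℝ) * -((j : ℝ) / n)) :=
        Real.exp_le_exp.mpr (by linarith)
    _ = ∏ _k ∈ Finset.Icc 1 j, Real.exp (-((j : ℝ) / n)) := by
        rw [Real.exp_nat_mul, Finset.prod_const, Nat.card_Icc, Nat.add_sub_cancel]
    _ ≤ _ := Finset.prod_le_prod (fun _ _ => (Real.exp_pos _).le) hfactor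

/-- There exist a constant `c' > 0` and a positive integer `N` such that
for all integers `n ≥ N` and all integers `n0` with `√n ≤ n0 ≤ n`,
`Σ_{j=1}^{n0} Π_{k=1}^{j} 1/(k/n + 1) ≥ c'·√n`. -/
theorem sum_prod_ge_sqrt :
    ∃ c' : ℝ, 0 < c' ∧ ∃ N : ℕ, 0 < N ∧ ∀ n : ℕ, N ≤ n → ∀ n0 : ℕ,
      Real.sqrt n ≤ (n0 : ℝ) → n0 ≤ n →
      c' * Real.sqrt n ≤
        ∑ j ∈ Finset.Icc 1 n0, ∏ k ∈ Finset.Icc 1 j, (1 / ((k : ℝ) / n + 1)) := by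
  refine ⟨Real.exp (-1) / 2, by positivity, 1, one_pos, fun n hn n0 hn0 _ => ?_⟩
  have hsqrt_le : Nat.sqrt n ≤ n0 := by
    exact_mod_cast Real.nat_sqrt_le_real_sqrt.trans hn0
  have hone_le : (1 : ℝ) ≤ Nat.sqrt n := by
    exact_mod_cast Nat.sqrt_pos.mpr hn
  have hlt : Real.sqrt n ≤ Nat.sqrt n + 1 := Real.real_sqrt_le_nat_sqrt_succ
  calc Real.exp (-1) / 2 * Real.sqrt n
      ≤ Real.exp (-1) / 2 * (2 * Nat.sqrt n) := by
        gcongr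
        linarith
    _ = ∑ _j ∈ Finset.Icc 1 (Nat.sqrt n), Real.exp (-1) := by
        rw [Finset.sum_const, Nat.card_Icc, Nat.add_sub_cancel, nsmul_eq_mul]
        ring
    _ ≤ ∑ j ∈ Finset.Icc 1 (Nat.sqrt n),
          ∏ k ∈ Finset.Icc 1 j, (1 / ((k : ℝ) / n + 1)) :=
        Finset.sum_le_sum fun j hj =>
          exp_neg_one_le_prod_one_div (Nat.le_sqrt.mp (Finset.mem_Icc.mp hj).2)
    _ ≤ _ := Finset.sum_le_sum_of_subset_of_nonneg
        (Finset.Icc_subset_Icc_right hsqrt_le)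
        fun _ _ _ => Finset.prod_nonneg fun _ _ => by positivity
end

section
/- Fix reals λ_s > 0, λ > 0, a real α with 1/2 ≤ α ≤ 1, and a real c > 0. Then there exist a constant c' > 0 and a positive integer N such that for all integers n ≥ N, if n_0 = ⌈n^{1−α}/c⌉ satisfies n_0 ≤ n, then the ring age satisfies D(n_0) ≥ c'·(λ_s/λ)·n^α. (This is the lower bound Ω(n^α) on the version age of the equidistantly jammed ring, the least harmful placement of ⌈c·n^α⌉ jammers, when α ≥ 1/2.) -/
/-- The attenuation product of an `m`-node mini-ring is at least `exp (-m² / n)`. -/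
lemma exp_neg_sq_div_le_prod (n m : ℕ) :
    Real.exp (-((m : ℝ) ^ 2 / n)) ≤
      ∏ k ∈ Finset.Icc 1 (m - 1), (1 / ((k : ℝ) / n + 1)) := by
  have factor_le : ∀ k ∈ Finset.Icc 1 (m - 1),
      Real.exp (-((m : ℝ) / n)) ≤ 1 / ((k : ℝ) / n + 1) := by
    intro k hk
    have hkm : (k : ℝ) ≤ m := by
      have := (Finset.mem_Icc.mp hk).2
      exact_mod_cast this.trans (Nat.sub_le m 1)
    rw [Real.exp_neg, ← one_div]
    apply one_div_le_one_div_of_le (by positivity)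
    calc (k : ℝ) / n + 1 ≤ (m : ℝ) / n + 1 := by gcongr
      _ ≤ Real.exp ((m : ℝ) / n) := Real.add_one_le_exp _
  calc Real.exp (-((m : ℝ) ^ 2 / n)) = Real.exp (-((m : ℝ) / n)) ^ m := by
        rw [← Real.exp_nat_mul]
        congr 1
        ring
    _ ≤ Real.exp (-((m : ℝ) / n)) ^ (m - 1) :=
        pow_le_pow_of_le_one (Real.exp_nonneg _)
          (Real.exp_le_one_iff.mpr (neg_nonpos.mpr (by positivity))) (Nat.sub_le m 1)
    _ = ∏ _k ∈ Finset.Icc 1 (m - 1), Real.exp (-((m : ℝ) / n)) := by simp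
    _ ≤ _ := Finset.prod_le_prod (fun _ _ => Real.exp_nonneg _) factor_le

/-- The ring age dominates its last term. -/
lemma le_ringAge {lamS lam : ℝ} (h : 0 ≤ lamS / lam) (n m : ℕ) :
    (lamS / lam) * ((n : ℝ) / m * Real.exp (-((m : ℝ) ^ 2 / n))) ≤ ringAge lamS lam n m := by
  unfold ringAge
  gcongr
  have hsum : 0 ≤ ∑ j ∈ Finset.Icc 1 (m - 1),
      ∏ k ∈ Finset.Icc 1 j, (1 / ((k : ℝ) / n + 1)) :=
    Finset.sum_nonneg fun _ _ => Finset.prod_nonneg fun _ _ => by positivity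
  have hlast := mul_le_mul_of_nonneg_left (exp_neg_sq_div_le_prod n m)
    (show 0 ≤ (n : ℝ) / m by positivity)
  linarith

/-- For `1/2 ≤ α ≤ 1` and `c > 0`: the version age of the equidistantly
jammed ring (mini-rings of size `n0 = ⌈n^{1−α}/c⌉`) is `Ω(n^α)`. -/
theorem equidistant_jammed_ring_age_lower_bound_large_alpha
    (lamS lam : ℝ) (hlamS : 0 < lamS) (hlam : 0 < lam)
    (α : ℝ) (hα0 : 1 / 2 ≤ α) (hα : α ≤ 1) (c : ℝ) (hc : 0 < c) :
    ∃ c' : ℝ, 0 < c' ∧ ∃ N : ℕ, 0 < N ∧ ∀ n : ℕ, N ≤ n →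
      ⌈(n : ℝ) ^ (1 - α) / c⌉₊ ≤ n →
      c' * (lamS / lam) * (n : ℝ) ^ α ≤ ringAge lamS lam n ⌈(n : ℝ) ^ (1 - α) / c⌉₊ := by
  set K : ℝ := 1 / c + 1 with hK
  have hKpos : 0 < K := by positivity
  refine ⟨Real.exp (-K ^ 2) / K, by positivity, 1, one_pos, fun n hn _ => ?_⟩
  have hn1 : (1 : ℝ) ≤ n := by exact_mod_cast hn
  have hn0 : (0 : ℝ) < n := by linarith
  have hratio : 0 ≤ lamS / lam := by positivity
  set p : ℝ := (n : ℝ) ^ (1 - α) with hp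
  have hp1 : 1 ≤ p := Real.one_le_rpow hn1 (by linarith)
  have hp0 : 0 < p := by linarith
  have hpα : p * (n : ℝ) ^ α = n := by
    rw [hp, ← Real.rpow_add hn0]
    simp
  have hp_sq : p ^ 2 ≤ n := by
    calc p ^ 2 = (n : ℝ) ^ ((1 - α) * 2) := by
          rw [hp, Real.rpow_mul hn0.le]
          norm_num
      _ ≤ (n : ℝ) ^ (1 : ℝ) := Real.rpow_le_rpow_of_exponent_le hn1 (by linarith)
      _ = n := Real.rpow_one _
  set m : ℕ := ⌈p / c⌉₊ with hm
  have hm0 : (0 : ℝ) < m := by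
    exact_mod_cast Nat.ceil_pos.mpr (by positivity : 0 < p / c)
  have hmK : (m : ℝ) ≤ K * p := by
    calc (m : ℝ) ≤ p / c + 1 := (Nat.ceil_lt_add_one (by positivity)).le
      _ ≤ p / c + p := by gcongr
      _ = K * p := by rw [hK]; ring
  have hexp : Real.exp (-K ^ 2) ≤ Real.exp (-((m : ℝ) ^ 2 / n)) := by
    apply Real.exp_le_exp.mpr
    apply neg_le_neg
    rw [div_le_iff₀ hn0]
    calc (m : ℝ) ^ 2 ≤ (K * p) ^ 2 := by gcongr
      _ = K ^ 2 * p ^ 2 := by ring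
      _ ≤ K ^ 2 * n := by gcongr
  have hdiv : (n : ℝ) ^ α / K ≤ (n : ℝ) / m := by
    rw [div_le_div_iff₀ hKpos hm0]
    calc (n : ℝ) ^ α * m ≤ (n : ℝ) ^ α * (K * p) := by gcongr
      _ = (p * (n : ℝ) ^ α) * K := by ring
      _ = n * K := by rw [hpα]
  calc Real.exp (-K ^ 2) / K * (lamS / lam) * (n : ℝ) ^ α
      = (lamS / lam) * ((n : ℝ) ^ α / K * Real.exp (-K ^ 2)) := by ring
    _ ≤ (lamS / lam) * ((n : ℝ) / m * Real.exp (-((m : ℝ) ^ 2 / n))) := by gcongr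
    _ ≤ ringAge lamS lam n m := le_ringAge hratio n m
end

section
/- Fix reals λ_s > 0, λ > 0. There exists a constant C > 0 such that for all positive integers n and ñ with 1 ≤ ñ ≤ n, the average age of the most harmfully jammed ring (ñ − 1 isolated nodes, each with age (λ_s/λ)·n, together with one mini-ring of n − ñ + 1 nodes) satisfies ( (ñ − 1)·(λ_s/λ)·n + g(n − ñ + 1) ) / n ≤ (λ_s/λ)·(ñ + C·√n). In particular, for ñ = ⌈c·n^α⌉ with α ∈ (0,1) the average age of the jammed ring is O(n^α) when α ≥ 1/2 and O(√n) when α < 1/2. -/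
/-- The partial products of `1 / (k / n + 1)` decay fast enough that their sum is at most `2 √n`. -/
theorem sum_prod_one_div_le_two_mul_sqrt (n M : ℕ) (hn : 0 < n) :
    ∑ j ∈ Finset.Icc 1 M, ∏ k ∈ Finset.Icc 1 j, (1 / ((k : ℝ) / n + 1)) ≤ 2 * Real.sqrt n := by
  have hn' : (0 : ℝ) < n := by exact_mod_cast hn
  set s := Real.sqrt n with hs
  have hs0 : 0 < s := Real.sqrt_pos.mpr hn'
  have hsq : s * s = n := Real.mul_self_sqrt hn'.le
  set a : ℕ → ℝ := fun j => ∏ k ∈ Finset.Icc 1 j, (1 / ((k : ℝ) / n + 1)) with ha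
  have hpos (j : ℕ) : 0 < a j := Finset.prod_pos fun k _ => by positivity
  have hle (j : ℕ) : a j ≤ 1 := Finset.prod_le_one (fun k _ => by positivity) fun k _ => by
    rw [div_le_one (by positivity)]
    exact le_add_of_nonneg_left (by positivity)
  have hstep (j : ℕ) : a j = a (j + 1) + a (j + 1) * ((j + 1 : ℕ) / n) := by
    simp only [ha, Finset.prod_Icc_succ_top (Nat.le_add_left 1 j)]
    field_simp
    ring
  have key (M : ℕ) : ∑ j ∈ Finset.Icc 1 M, a j + s * a M ≤ s + min (M : ℝ) s := by
    induction M with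
    | zero => simp [ha, hs0.le]
    | succ M ih =>
      rw [Finset.sum_Icc_succ_top (Nat.le_add_left 1 M)]
      rcases le_total s ((M + 1 : ℕ) : ℝ) with h | h
      · have hmul : a (M + 1) ≤ s * (a (M + 1) * ((M + 1 : ℕ) / n)) := by
          have h1 : 1 ≤ s * (((M + 1 : ℕ) : ℝ) / n) := by
            rw [← mul_div_assoc, one_le_div hn', ← hsq]
            exact mul_le_mul_of_nonneg_left h hs0.le
          nlinarith [hpos (M + 1)]
        rw [hstep M] at ih
        rw [min_eq_right h]
        linarith [min_le_right (M : ℝ) s]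
      · have hmono : a (M + 1) ≤ a M := by
          rw [hstep M]
          exact le_add_of_nonneg_right (mul_nonneg (hpos _).le (by positivity))
        rw [min_eq_left h]
        push_cast
        linarith [min_le_left (M : ℝ) s, hle (M + 1), mul_le_mul_of_nonneg_left hmono hs0.le]
  linarith [key M, min_le_right (M : ℝ) s, mul_pos hs0 (hpos M)]

/-- Upper bound on the average age of the most harmfully jammed ring:
`ñ − 1` isolated nodes of age `(lamS/lam)·n` each plus one mini-ring of `n − ñ + 1` nodes.
There is a constant `C > 0` with
`((ñ−1)·(lamS/lam)·n + g(n−ñ+1))/n ≤ (lamS/lam)·(ñ + C·√n)` for all `1 ≤ ñ ≤ n`. -/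
theorem worst_case_jammed_ring_average_age_upper_bound
    (lamS lam : ℝ) (hlamS : 0 < lamS) (hlam : 0 < lam) :
    ∃ C : ℝ, 0 < C ∧ ∀ n ntilde : ℕ, 1 ≤ ntilde → ntilde ≤ n →
      (((ntilde : ℝ) - 1) * (lamS / lam) * n + totalRingAge lamS lam n (n - ntilde + 1)) / n
        ≤ (lamS / lam) * ((ntilde : ℝ) + C * Real.sqrt n) := by
  refine ⟨2, two_pos, fun n ntilde h1 h2 => ?_⟩
  have hn : 0 < n := h1.trans h2
  have hn' : (0 : ℝ) < n := by exact_mod_cast hn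
  set m := n - ntilde + 1 with hm
  have hm0 : (0 : ℝ) < m := by exact_mod_cast Nat.succ_pos _
  have hmn : (m : ℝ) ≤ n := by exact_mod_cast (by omega : m ≤ n)
  unfold totalRingAge ringAge
  have hS := sum_prod_one_div_le_two_mul_sqrt n (m - 1) hn
  have hS0 : 0 ≤ ∑ j ∈ Finset.Icc 1 (m - 1), ∏ k ∈ Finset.Icc 1 j, (1 / ((k : ℝ) / n + 1)) :=
    Finset.sum_nonneg fun j _ => Finset.prod_nonneg fun k _ => by positivity
  have hP : ∏ k ∈ Finset.Icc 1 (m - 1), (1 / ((k : ℝ) / n + 1)) ≤ 1 :=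
    Finset.prod_le_one (fun k _ => by positivity) fun k _ => by
      rw [div_le_one (by positivity)]
      exact le_add_of_nonneg_left (by positivity)
  set S := ∑ j ∈ Finset.Icc 1 (m - 1), ∏ k ∈ Finset.Icc 1 j, (1 / ((k : ℝ) / n + 1))
  set P := ∏ k ∈ Finset.Icc 1 (m - 1), (1 / ((k : ℝ) / n + 1))
  have heq : (((ntilde : ℝ) - 1) * (lamS / lam) * n + m * (lamS / lam * (S + n / m * P))) / n
      = lamS / lam * ((ntilde : ℝ) - 1 + m / n * S + P) := by
    field_simp
    ring
  rw [heq]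
  have hmS : m / n * S ≤ S := mul_le_of_le_one_left hS0 ((div_le_one hn').mpr hmn)
  exact mul_le_mul_of_nonneg_left (by linarith) (by positivity)
end

section
/- Let V be a finite set, λ_s > 0, λ_0 : V → ℝ with λ_0(j) > 0 for all j, and let λ, λ̄ : V × V → ℝ be nonnegative inter-node rate functions that agree everywhere except possibly on the two ordered pairs (a,b) and (b,a) for some distinct a, b ∈ V, where λ(a,b) = λ(b,a) = 0 and λ̄(a,b) ≥ 0, λ̄(b,a) ≥ 0 (a new link is introduced between a and b). Let Δ and Δ̄ be Yates age functions for the networks with rates λ and λ̄ respectively, each additionally satisfying set-monotonicity. Then Δ̄(S) ≤ Δ(S) for every nonempty S ⊆ V; in particular, the version age at every node ℓ satisfies Δ̄({ℓ}) ≤ Δ({ℓ}). -/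
/-- A Yates age function for a gossip network on the finite node set `V`, with source
self-update rate `lamS`, source-to-node rates `lam0`, and inter-node rates `lam i j`
(rate at which node `i` updates node `j`): for every nonempty `S ⊆ V`,
`Δ(S) = (lamS + Σ_{i∉S} (Σ_{j∈S} lam i j)·Δ(S∪{i})) / (Σ_{j∈S} lam0 j + Σ_{i∉S} Σ_{j∈S} lam i j)`. -/
def IsYatesAge {V : Type*} [Fintype V] [DecidableEq V]
    (lamS : ℝ) (lam0 : V → ℝ) (lam : V → V → ℝ) (Δ : Finset V → ℝ) : Prop :=
  ∀ S : Finset V, S.Nonempty →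
    Δ S = (lamS + ∑ i ∈ Sᶜ, (∑ j ∈ S, lam i j) * Δ (insert i S)) /
      ((∑ j ∈ S, lam0 j) + ∑ i ∈ Sᶜ, ∑ j ∈ S, lam i j)

/-- The Yates recursion with the denominator cleared, the inter-node terms written as increments. -/
theorem IsYatesAge.mul_sum_eq {V : Type*} [Fintype V] [DecidableEq V]
    {lamS : ℝ} {lam0 : V → ℝ} {lam : V → V → ℝ} {Δ : Finset V → ℝ}
    (hΔ : IsYatesAge lamS lam0 lam Δ) (hlam0 : ∀ j, 0 < lam0 j) (hlam : ∀ i j, 0 ≤ lam i j)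
    {S : Finset V} (hS : S.Nonempty) :
    Δ S * ∑ j ∈ S, lam0 j =
      lamS + ∑ i ∈ Sᶜ, (∑ j ∈ S, lam i j) * (Δ (insert i S) - Δ S) := by
  have hpos : 0 < (∑ j ∈ S, lam0 j) + ∑ i ∈ Sᶜ, ∑ j ∈ S, lam i j :=
    add_pos_of_pos_of_nonneg (Finset.sum_pos (fun j _ => hlam0 j) hS)
      (Finset.sum_nonneg fun i _ => Finset.sum_nonneg fun j _ => hlam i j)
  have h := (eq_div_iff hpos.ne').1 (hΔ S hS)
  simp only [mul_sub, Finset.sum_sub_distrib, ← Finset.sum_mul]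
  linarith

/-- Increasing inter-node rates can only lower the version age, provided the age function of the
network with the larger rates is set-monotone. -/
theorem IsYatesAge.le_of_rates_le {V : Type*} [Fintype V] [DecidableEq V]
    {lamS : ℝ} {lam0 : V → ℝ} {lam lamBar : V → V → ℝ} {Δ ΔBar : Finset V → ℝ}
    (hΔ : IsYatesAge lamS lam0 lam Δ) (hΔBar : IsYatesAge lamS lam0 lamBar ΔBar)
    (hlam0 : ∀ j, 0 < lam0 j) (hlam : ∀ i j, 0 ≤ lam i j)
    (hle : ∀ i j, lam i j ≤ lamBar i j)
    (hmonoBar : ∀ S T : Finset V, S.Nonempty → S ⊆ T → ΔBar T ≤ ΔBar S)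
    (S : Finset V) (hS : S.Nonempty) : ΔBar S ≤ Δ S := by
  induction S using WellFoundedGT.induction with
  | ind S ih =>
    have h := hΔ.mul_sum_eq hlam0 hlam hS
    have hBar := hΔBar.mul_sum_eq hlam0 (fun i j => (hlam i j).trans (hle i j)) hS
    have hL : 0 < ∑ j ∈ S, lam0 j := Finset.sum_pos (fun j _ => hlam0 j) hS
    by_contra! hlt
    have hsum : ∑ i ∈ Sᶜ, (∑ j ∈ S, lamBar i j) * (ΔBar (insert i S) - ΔBar S) ≤
        ∑ i ∈ Sᶜ, (∑ j ∈ S, lam i j) * (Δ (insert i S) - Δ S) := by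
      refine Finset.sum_le_sum fun i hi => ?_
      have hinc := hmonoBar S (insert i S) hS (Finset.subset_insert i S)
      have hnext := ih (insert i S) (Finset.ssubset_insert (Finset.mem_compl.1 hi))
        (Finset.insert_nonempty i S)
      calc (∑ j ∈ S, lamBar i j) * (ΔBar (insert i S) - ΔBar S)
          ≤ (∑ j ∈ S, lam i j) * (ΔBar (insert i S) - ΔBar S) :=
            mul_le_mul_of_nonpos_right (Finset.sum_le_sum fun j _ => hle i j) (by linarith)
        _ ≤ (∑ j ∈ S, lam i j) * (Δ (insert i S) - Δ S) :=
            mul_le_mul_of_nonneg_left (by linarith) (Finset.sum_nonneg fun j _ => hlam i j)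
    have := mul_lt_mul_of_pos_right hlt hL
    linarith


/-- Introducing a new link between two previously disconnected nodes
`a` and `b` can only lower the version age: if `lam` and `lamBar` agree except on the
ordered pairs `(a,b)` and `(b,a)`, where `lam a b = lam b a = 0`, and `Δ`, `ΔBar` are
set-monotone Yates age functions for the two networks, then `ΔBar S ≤ Δ S` for every
nonempty `S ⊆ V`; in particular `ΔBar {ℓ} ≤ Δ {ℓ}` for every node `ℓ`. -/
theorem adding_link_reduces_age {V : Type*} [Fintype V] [DecidableEq V]
    (lamS : ℝ) (hlamS : 0 < lamS)
    (lam0 : V → ℝ) (hlam0 : ∀ j, 0 < lam0 j)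
    (lam lamBar : V → V → ℝ)
    (hlam : ∀ i j, 0 ≤ lam i j) (hlamBar : ∀ i j, 0 ≤ lamBar i j)
    (a b : V) (hab : a ≠ b)
    (hagree : ∀ i j : V, (i, j) ≠ (a, b) → (i, j) ≠ (b, a) → lam i j = lamBar i j)
    (hzab : lam a b = 0) (hzba : lam b a = 0)
    (Δ ΔBar : Finset V → ℝ)
    (hΔ : IsYatesAge lamS lam0 lam Δ)
    (hΔBar : IsYatesAge lamS lam0 lamBar ΔBar)
    (hmono : ∀ S T : Finset V, S.Nonempty → S ⊆ T → Δ T ≤ Δ S)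
    (hmonoBar : ∀ S T : Finset V, S.Nonempty → S ⊆ T → ΔBar T ≤ ΔBar S) :
    ∀ S : Finset V, S.Nonempty → ΔBar S ≤ Δ S := by
  refine hΔ.le_of_rates_le hΔBar hlam0 hlam (fun i j => ?_) hmonoBar
  by_cases h₁ : (i, j) = (a, b)
  · obtain ⟨rfl, rfl⟩ := Prod.mk.inj h₁
    exact hzab.trans_le (hlamBar _ _)
  by_cases h₂ : (i, j) = (b, a)
  · obtain ⟨rfl, rfl⟩ := Prod.mk.inj h₂
    exact hzba.trans_le (hlamBar _ _)
  exact (hagree i j h₁ h₂).le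
end

section
/- Fix reals λ_s > 0, λ > 0 and positive integers n, d with d ≥ 0. Let F : {0,1,…,d} → ℝ satisfy F(d) = λ_s·n/((d+1)·λ) and F(d_1) = ( λ_s + (d − d_1)·(λ/n)·F(d_1 + 1) ) / ( (d+1)·λ/n ) for 0 ≤ d_1 < d. Then F(0) = (λ_s/λ)·(n/(d+1))·( 1 + Σ_{d_2=0}^{d−1} Π_{d_1=0}^{d_2} (d − d_1)/(d + 1) ). (F(d_1) is the age of the set consisting of a degree-d node together with d_1 of its degree-one neighbors in a star network where all links and source rates equal λ/n, so F(0) is the maximum possible version age of a degree-d node.) -/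
/-- Unrolling the first `k` steps of an affine recursion `F j = c + a j * F (j + 1)`. -/
theorem affine_recursion_unroll {R : Type*} [CommSemiring R] (c : R) (a F : ℕ → R) (k : ℕ)
    (h : ∀ j < k, F j = c + a j * F (j + 1)) :
    F 0 = c * ∑ j ∈ Finset.range k, ∏ i ∈ Finset.range j, a i +
      (∏ i ∈ Finset.range k, a i) * F k := by
  induction k with
  | zero => simp
  | succ k ih =>
    rw [ih fun j hj => h j (hj.trans k.lt_succ_self), h k k.lt_succ_self,
      Finset.sum_range_succ, Finset.prod_range_succ]
    ring

/-- Closed form for the maximum possible version age of a degree-`d`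
node: in a star network (center of degree `d` connected to `d` degree-one leaves, all
link and source rates `lam/n`, source self-update rate `lamS`), the ages
`F d₁` of the set consisting of the center and `d₁` leaves satisfy the Yates recursion
`F d = lamS·n/((d+1)·lam)`, `F d₁ = (lamS + (d−d₁)·(lam/n)·F(d₁+1))/((d+1)·lam/n)`,
and hence
`F 0 = (lamS/lam)·(n/(d+1))·(1 + Σ_{d₂=0}^{d−1} Π_{d₁=0}^{d₂} (d−d₁)/(d+1))`. -/
theorem star_center_age_closed_form
    (lamS lam : ℝ) (hlamS : 0 < lamS) (hlam : 0 < lam)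
    (n : ℕ) (hn : 0 < n) (d : ℕ)
    (F : ℕ → ℝ)
    (hFd : F d = lamS * n / (((d : ℝ) + 1) * lam))
    (hrec : ∀ d1 : ℕ, d1 < d →
      F d1 = (lamS + ((d : ℝ) - d1) * (lam / n) * F (d1 + 1)) / (((d : ℝ) + 1) * lam / n)) :
    F 0 = (lamS / lam) * ((n : ℝ) / ((d : ℝ) + 1)) *
      (1 + ∑ d2 ∈ Finset.range d, ∏ d1 ∈ Finset.range (d2 + 1),
        ((d : ℝ) - d1) / ((d : ℝ) + 1)) := by
  have hlam' : lam ≠ 0 := hlam.ne'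
  have hn' : (n : ℝ) ≠ 0 := by positivity
  have hd : (d : ℝ) + 1 ≠ 0 := by positivity
  have hstep : ∀ j < d, F j = lamS / lam * (n / ((d : ℝ) + 1)) +
      ((d : ℝ) - j) / ((d : ℝ) + 1) * F (j + 1) := by
    intro j hj
    rw [hrec j hj]
    field_simp
  have hlast : F d = lamS / lam * (n / ((d : ℝ) + 1)) := by
    rw [hFd]
    field_simp
  rw [affine_recursion_unroll _ (fun j : ℕ => ((d : ℝ) - j) / ((d : ℝ) + 1)) F d hstep, hlast,
    mul_comm (∏ i ∈ Finset.range d, _), ← mul_add, ← Finset.sum_range_succ,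
    Finset.sum_range_succ', Finset.prod_range_zero, add_comm (1 : ℝ) (∑ _ ∈ _, _)]
end

section
/- Define for each integer d ≥ 0 the real number r(d) = 1 − (1/(d+1))·( 1 + Σ_{d_2=0}^{d−1} Π_{d_1=0}^{d_2} (d − d_1)/(d + 1) ), where the empty sum is 0. Then r is nondecreasing: r(d) ≤ r(d+1) for all integers d ≥ 0. (Equivalently, the minimum age reduction R_d = (λ_s/λ)·n·r(d) obtained by attaching d rate-λ/n links to a previously isolated node is an increasing function of the degree d.) -/
/-- The coefficient `r(d)` such that `(lamS/lam)·n·r(d)` is the age reduction obtained by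
attaching `d` rate-`lam/n` links (to degree-one nodes) to a previously isolated node:
`r(d) = 1 − (1/(d+1))·(1 + Σ_{d₂=0}^{d−1} Π_{d₁=0}^{d₂} (d−d₁)/(d+1))`. -/
noncomputable def rCoeff (d : ℕ) : ℝ :=
  1 - (1 / ((d : ℝ) + 1)) *
    (1 + ∑ d2 ∈ Finset.range d, ∏ d1 ∈ Finset.range (d2 + 1),
      ((d : ℝ) - d1) / ((d : ℝ) + 1))

/-- The product `∏_{i<k} (d - i)/(d + 1)`, the `k`-th term in the age of a degree-`d` node. -/
noncomputable def ageTerm (d k : ℕ) : ℝ :=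
  ∏ i ∈ Finset.range k, ((d : ℝ) - i) / ((d : ℝ) + 1)

lemma ageTerm_succ (d k : ℕ) :
    ageTerm d (k + 1) = ageTerm d k * (((d : ℝ) - k) / ((d : ℝ) + 1)) :=
  Finset.prod_range_succ _ _

lemma ageTerm_self_add_one (d : ℕ) : ageTerm d (d + 1) = 0 := by
  simp [ageTerm_succ]

lemma ageTerm_nonneg {d k : ℕ} (hk : k ≤ d + 1) : 0 ≤ ageTerm d k := by
  refine Finset.prod_nonneg fun i hi => div_nonneg ?_ (by positivity)
  have : i ≤ d := by have := Finset.mem_range.mp hi; omega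
  exact sub_nonneg.mpr (by exact_mod_cast this)

lemma ageTerm_succ_succ (d k : ℕ) :
    ageTerm (d + 1) (k + 1) = (((d : ℝ) + 1) / ((d : ℝ) + 2)) ^ (k + 1) * ageTerm d k := by
  induction k with
  | zero =>
    simp only [ageTerm, zero_add, Finset.prod_range_one, Finset.prod_range_zero]
    push_cast
    ring
  | succ k ih =>
    have hcast : (d : ℝ) + 1 + 1 = d + 2 := by ring
    rw [ageTerm_succ, ih, ageTerm_succ d k, pow_succ _ (k + 1)]
    push_cast
    rw [hcast]
    field_simp
    ring

lemma rCoeff_eq (d : ℕ) :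
    rCoeff d = 1 - (∑ k ∈ Finset.range (d + 1), ageTerm d k) / ((d : ℝ) + 1) := by
  rw [Finset.sum_range_succ']
  simp only [rCoeff, ageTerm, Finset.range_zero, Finset.prod_empty]
  ring

lemma sum_ageTerm_mul (d n : ℕ) :
    ∑ k ∈ Finset.range n, ageTerm d k * ((k : ℝ) + 1) = ((d : ℝ) + 1) * (1 - ageTerm d n) := by
  induction n with
  | zero => simp [ageTerm]
  | succ n ih =>
    rw [Finset.sum_range_succ, ih, ageTerm_succ]
    field_simp
    ring

lemma sum_ageTerm_mul_sq (d n : ℕ) :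
    ∑ k ∈ Finset.range n, ageTerm d k * ((k : ℝ) + 1) ^ 2 =
      ((d : ℝ) + 1) * (∑ k ∈ Finset.range n, ageTerm d k - n * ageTerm d n) := by
  induction n with
  | zero => simp
  | succ n ih =>
    rw [Finset.sum_range_succ, Finset.sum_range_succ, ih, ageTerm_succ]
    push_cast
    field_simp
    ring

lemma div_add_one_pow_le {x : ℝ} (hx : 0 < x) (m : ℕ) :
    (x / (x + 1)) ^ m ≤ 1 - m / x + (m : ℝ) ^ 2 / x ^ 2 := by
  have bernoulli : 1 + (m : ℝ) * (1 / x) ≤ (1 + 1 / x) ^ m :=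
    one_add_mul_le_pow (by have := one_div_pos.mpr hx; linarith) m
  have hinv : x / (x + 1) = (1 + 1 / x)⁻¹ := by field_simp
  have hy : 0 ≤ (m : ℝ) / x := by positivity
  calc (x / (x + 1)) ^ m = ((1 + 1 / x) ^ m)⁻¹ := by rw [hinv, inv_pow]
    _ ≤ (1 + (m : ℝ) * (1 / x))⁻¹ := inv_anti₀ (by positivity) bernoulli
    _ = 1 / (1 + m / x) := by rw [mul_one_div, one_div]
    _ ≤ 1 - m / x + (m / x) ^ 2 := by
      rw [div_le_iff₀ (by positivity)]
      nlinarith [pow_nonneg hy 3]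
    _ = 1 - m / x + (m : ℝ) ^ 2 / x ^ 2 := by rw [div_pow]

lemma sum_ageTerm_succ_le (d : ℕ) :
    ∑ k ∈ Finset.range (d + 2), ageTerm (d + 1) k ≤
      ((d : ℝ) + 2) / ((d : ℝ) + 1) * ∑ k ∈ Finset.range (d + 1), ageTerm d k := by
  set N : ℝ := (d : ℝ) + 1 with hN
  have hN0 : 0 < N := by positivity
  have hN2 : (d : ℝ) + 2 = N + 1 := by rw [hN]; ring
  have first := sum_ageTerm_mul d (d + 1)
  have second := sum_ageTerm_mul_sq d (d + 1)
  rw [ageTerm_self_add_one, sub_zero, mul_one, ← hN] at first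
  rw [ageTerm_self_add_one, mul_zero, sub_zero, ← hN] at second
  have tail : ∑ k ∈ Finset.range (d + 1), ageTerm (d + 1) (k + 1) ≤
      ∑ k ∈ Finset.range (d + 1), (ageTerm d k - ageTerm d k * ((k : ℝ) + 1) / N +
        ageTerm d k * ((k : ℝ) + 1) ^ 2 / N ^ 2) := by
    refine Finset.sum_le_sum fun k hk => ?_
    have bound := mul_le_mul_of_nonneg_right (div_add_one_pow_le hN0 (k + 1))
      (ageTerm_nonneg (Finset.mem_range.mp hk).le)
    rw [ageTerm_succ_succ, hN2, ← hN]
    refine bound.trans_eq ?_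
    push_cast
    ring
  rw [Finset.sum_add_distrib, Finset.sum_sub_distrib, ← Finset.sum_div, ← Finset.sum_div,
    first, second] at tail
  rw [Finset.sum_range_succ', hN2]
  have zeroth : ageTerm (d + 1) 0 = 1 := by simp [ageTerm]
  rw [zeroth]
  refine (add_le_add_left tail 1).trans_eq ?_
  field_simp
  ring

/-- The minimum age reduction coefficient `r(d)` is nondecreasing in the
degree `d`. -/
theorem rCoeff_monotone : ∀ d : ℕ, rCoeff d ≤ rCoeff (d + 1) := by
  intro d
  have h := sum_ageTerm_succ_le d
  rw [rCoeff_eq, rCoeff_eq]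
  refine sub_le_sub_left ?_ 1
  push_cast
  rw [div_le_iff₀ (by positivity)]
  refine h.trans_eq ?_
  field_simp
  ring
end

section
/- Fix reals λ_s > 0, λ > 0 and positive integers n, k with k ≥ 1. Let δ : {1,…,k} → ℝ satisfy δ(k) = λ_s·n/(k·λ) and δ(m) = ( λ_s + (k − m)·(m·λ/n)·δ(m+1) ) / ( m·λ/n + (k − m)·(m·λ/n) ) for 1 ≤ m < k. Then δ(1) = (λ_s/λ)·(n/k)·Σ_{j=1}^{k} 1/j; that is, the version age at each node of a mini fully connected network (mini-FC) of k nodes equals (λ_s/λ)·(n/k)·H_k. -/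
/-- If `(k + 1 - m) δ m = c / m + (k - m) δ (m + 1)` for `1 ≤ m < k`, unrolling from `1` to `m`
expresses `k * δ 1` through `δ m` and a partial harmonic sum. -/
lemma mul_one_eq_sum_Ico_add {c : ℝ} {k : ℕ} {δ : ℕ → ℝ}
    (h : ∀ m : ℕ, 1 ≤ m → m < k →
      ((k : ℝ) + 1 - m) * δ m = c * (1 / m) + ((k : ℝ) - m) * δ (m + 1))
    {m : ℕ} (hm : 1 ≤ m) (hmk : m ≤ k) :
    k * δ 1 = c * ∑ j ∈ Finset.Ico 1 m, (1 / (j : ℝ)) + ((k : ℝ) + 1 - m) * δ m := by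
  induction m, hm using Nat.le_induction with
  | base => simp
  | succ m hm ih =>
    rw [ih (by omega), Finset.sum_Ico_succ_top hm, h m hm (by omega)]
    push_cast
    ring

/-- The version age at each node of a mini fully connected network
(mini-FC) of `k` nodes equals `(lamS/lam)·(n/k)·H_k`: if `δ m` denotes the Yates age of
any `m`-element subset of the mini-FC, satisfying `δ k = lamS·n/(k·lam)` and
`δ m = (lamS + (k−m)·(m·lam/n)·δ(m+1))/(m·lam/n + (k−m)·(m·lam/n))` for `1 ≤ m < k`,
then `δ 1 = (lamS/lam)·(n/k)·Σ_{j=1}^{k} 1/j`. -/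
theorem miniFC_node_age
    (lamS lam : ℝ) (hlamS : 0 < lamS) (hlam : 0 < lam)
    (n k : ℕ) (hn : 0 < n) (hk : 1 ≤ k)
    (δ : ℕ → ℝ)
    (hend : δ k = lamS * n / (k * lam))
    (hrec : ∀ m : ℕ, 1 ≤ m → m < k →
      δ m = (lamS + ((k : ℝ) - m) * ((m : ℝ) * lam / n) * δ (m + 1)) /
        ((m : ℝ) * lam / n + ((k : ℝ) - m) * ((m : ℝ) * lam / n))) :
    δ 1 = (lamS / lam) * ((n : ℝ) / k) * ∑ j ∈ Finset.Icc 1 k, (1 / (j : ℝ)) := by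
  have hn' : (0 : ℝ) < n := by exact_mod_cast hn
  have hk' : (0 : ℝ) < k := by exact_mod_cast hk
  have hstep : ∀ m : ℕ, 1 ≤ m → m < k → ((k : ℝ) + 1 - m) * δ m =
      lamS * n / lam * (1 / m) + ((k : ℝ) - m) * δ (m + 1) := by
    intro m hm hmk
    have hm' : (0 : ℝ) < m := by exact_mod_cast hm
    have hmk' : (m : ℝ) < k := by exact_mod_cast hmk
    have hden : (m : ℝ) * lam / n + ((k : ℝ) - m) * ((m : ℝ) * lam / n) ≠ 0 := by
      have := sub_pos.2 hmk'
      positivity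
    have hδ := (eq_div_iff hden).1 (hrec m hm hmk)
    field_simp at hδ ⊢
    linear_combination hδ
  have hsum := mul_one_eq_sum_Ico_add hstep hk le_rfl
  rw [hend] at hsum
  rw [← Finset.Ico_succ_right_eq_Icc, Nat.succ_eq_succ, Finset.sum_Ico_succ_top hk]
  apply mul_left_cancel₀ hk'.ne'
  rw [hsum]
  field_simp
  ring
end

section
/- Fix reals λ_s > 0, λ > 0 and positive integers n, k with k + 1 ≤ n. Consider the network on node set V = {1,…,n} with source self-update rate λ_s, source-to-node rates λ_0(j) = λ/n for all j, and inter-node rates λ(i,j) = λ/n whenever i ≠ j and both i, j ∈ {1,…,k} (a mini-FC on the first k nodes), all other inter-node rates 0. Let E be any set of exactly k unordered pairs of distinct nodes of V, none of which is a pair contained in {1,…,k}, and let λ̄ equal λ except that λ̄(i,j) = λ̄(j,i) = λ/n for every pair {i,j} ∈ E (k new links are added). Let Δ̄ be a Yates age function for the network with rates λ̄, additionally satisfying set-monotonicity. Then the total network age satisfies Σ_{i∈V} Δ̄({i}) ≤ (λ_s/λ)·( n·Σ_{j=1}^{k+1} 1/j + n·(n − k − 1) ), with equality when E connects a single node outside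 {1,…,k} to all k nodes of the mini-FC, producing a mini-FC of k+1 nodes and n − k − 1 isolated nodes. -/
open Finset in
/-- A set-monotone Yates age function, normalized so that every source-to-node rate and the
age of an isolated node are `1`. -/
structure IsNormalizedAge {V : Type*} [Fintype V] [DecidableEq V]
    (a : V → V → ℝ) (D : Finset V → ℝ) : Prop where
  rate_nonneg : ∀ i j, 0 ≤ a i j
  balance : ∀ S : Finset V, S.Nonempty →
    (#S : ℝ) * D S + ∑ i ∈ Sᶜ, (∑ j ∈ S, a i j) * (D S - D (insert i S)) = 1
  anti : ∀ S T : Finset V, S.Nonempty → S ⊆ T → D T ≤ D S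

/-- The normalized age of a set of `j` nodes in a clique of `m` nodes. -/
noncomputable def cliqueAge (m j : ℕ) : ℝ :=
  (∑ i ∈ Finset.Icc j m, 1 / (i : ℝ)) / ((m : ℝ) - j + 1)

open Finset in
/-- The 0-1 matrix `x` describes `k` links added to the clique `K` of `k` nodes, where `W` is the
set of nodes outside `K` touched by the new links, and `a` dominates the resulting rates. -/
structure IsCliqueExtension {V : Type*} [Fintype V] [DecidableEq V]
    (K W : Finset V) (k : ℕ) (x a : V → V → ℝ) : Prop where
  card_clique : #K = k
  pos : 0 < k
  disj : Disjoint K W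
  symm : ∀ i j, x i j = x j i
  zero_or_one : ∀ i j, x i j = 0 ∨ x i j = 1
  diag : ∀ i, x i i = 0
  eq_zero_of_mem : ∀ i ∈ K, ∀ j ∈ K, x i j = 0
  supp : ∀ i j, x i j ≠ 0 → j ∈ K ∪ W
  exists_link : ∀ w ∈ W, ∃ i, x i w = 1
  total : ∑ i, ∑ j, x i j = 2 * (k : ℝ)
  rate_clique : ∀ i ∈ K, ∀ j ∈ K, i ≠ j → 1 ≤ a i j
  le_rate : ∀ i j, x i j ≤ a i j

lemma cliqueAge_self {m : ℕ} : cliqueAge m m = 1 / m := by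
  simp [cliqueAge]

lemma cliqueAge_one {m : ℕ} :
    (m : ℝ) * cliqueAge m 1 = ∑ i ∈ Finset.Icc 1 m, 1 / (i : ℝ) := by
  unfold cliqueAge
  rcases Nat.eq_zero_or_pos m with rfl | hm
  · simp
  · have : (m : ℝ) ≠ 0 := by positivity
    rw [Nat.cast_one, sub_add_cancel, mul_div_cancel₀ _ this]

lemma cliqueAge_rec {m j : ℕ} (hj : 0 < j) (hjm : j < m) :
    (j : ℝ) * cliqueAge m j
      + (j : ℝ) * ((m : ℝ) - j) * (cliqueAge m j - cliqueAge m (j + 1)) = 1 := by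
  unfold cliqueAge
  rw [← Finset.insert_Icc_succ_left_eq_Icc hjm.le,
    Finset.sum_insert (by simp), Nat.succ_eq_succ, Nat.succ_eq_add_one]
  have h1 : (0 : ℝ) < j := by exact_mod_cast hj
  have h2 : (0 : ℝ) < (m : ℝ) - j := by
    have : (j : ℝ) < m := by exact_mod_cast hjm
    linarith
  have h3 : (m : ℝ) - j + 1 ≠ 0 := by positivity
  have h4 : (m : ℝ) - ((j + 1 : ℕ) : ℝ) + 1 = (m : ℝ) - j := by push_cast; ring
  rw [h4]
  have h2' := h2.ne'
  field_simp
  ring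

lemma sum_Icc_one_div_succ (k : ℕ) :
    ∑ i ∈ Finset.Icc 1 (k + 1), 1 / (i : ℝ) =
      ∑ i ∈ Finset.Icc 1 k, 1 / (i : ℝ) + 1 / ((k : ℝ) + 1) := by
  rw [Finset.sum_Icc_succ_top (by omega), Nat.cast_add_one]

namespace IsNormalizedAge

open Finset

variable {V : Type*} [Fintype V] [DecidableEq V] {a : V → V → ℝ} {D : Finset V → ℝ}

lemma card_mul_add_sum_le (h : IsNormalizedAge a D) {S T : Finset V} (hS : S.Nonempty)
    (hT : Disjoint S T) {w : V → ℝ} (hw : ∀ i ∈ T, w i ≤ ∑ j ∈ S, a i j) :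
    (#S : ℝ) * D S + ∑ i ∈ T, w i * (D S - D (insert i S)) ≤ 1 := by
  have hd : ∀ i, 0 ≤ D S - D (insert i S) := fun i =>
    sub_nonneg.2 (h.anti _ _ hS (subset_insert _ _))
  have hsub : T ⊆ Sᶜ := fun i hi => mem_compl.2 fun hiS => disjoint_left.1 hT hiS hi
  rw [← h.balance S hS]
  gcongr
  refine (sum_le_sum fun i hi => mul_le_mul_of_nonneg_right (hw i hi) (hd i)).trans ?_
  exact sum_le_sum_of_subset_of_nonneg hsub fun i _ _ =>
    mul_nonneg (sum_nonneg fun j _ => h.rate_nonneg i j) (hd i)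

lemma card_mul_le_one (h : IsNormalizedAge a D) {S : Finset V} (hS : S.Nonempty) :
    (#S : ℝ) * D S ≤ 1 := by
  simpa using h.card_mul_add_sum_le (T := ∅) (w := 0) hS (by simp) (by simp)

lemma card_add_mul_le (h : IsNormalizedAge a D) {S T : Finset V} (hS : S.Nonempty)
    (hT : Disjoint S T) {m q : ℝ} (hm : 0 ≤ m) (hmT : m ≤ ∑ i ∈ T, ∑ j ∈ S, a i j)
    (hq : ∀ i ∈ T, D (insert i S) ≤ q) : (#S + m) * D S ≤ 1 + m * q := by
  have h1 := h.card_mul_le_one hS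
  rcases le_total q (D S) with hle | hle
  · have h2 := h.card_mul_add_sum_le hS hT (w := fun i => ∑ j ∈ S, a i j) fun i _ => le_rfl
    have h3 : (∑ i ∈ T, ∑ j ∈ S, a i j) * (D S - q) ≤
        ∑ i ∈ T, (∑ j ∈ S, a i j) * (D S - D (insert i S)) := by
      rw [sum_mul]
      exact sum_le_sum fun i hi => mul_le_mul_of_nonneg_left (by linarith [hq i hi])
        (sum_nonneg fun j _ => h.rate_nonneg i j)
    have h4 := mul_le_mul_of_nonneg_right hmT (sub_nonneg.2 hle)
    linarith
  · have := mul_le_mul_of_nonneg_left hle hm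
    linarith

lemma le_cliqueAge (h : IsNormalizedAge a D) {K : Finset V}
    (hK : ∀ i ∈ K, ∀ j ∈ K, i ≠ j → 1 ≤ a i j) {S : Finset V} (hS : S.Nonempty) (hSK : S ⊆ K) :
    D S ≤ cliqueAge #K #S := by
  have hpos : (0 : ℝ) < #S := by exact_mod_cast hS.card_pos
  have hcard := h.card_mul_le_one hS
  rcases (card_le_card hSK).eq_or_lt with heq | hlt
  · rw [← heq, cliqueAge_self, le_div_iff₀ hpos]
    linarith
  · have hrec := cliqueAge_rec hS.card_pos hlt
    have hlt' : (0 : ℝ) ≤ (#K : ℝ) - #S := by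
      have : (#S : ℝ) < #K := by exact_mod_cast hlt
      linarith
    have hb := h.card_mul_add_sum_le hS (T := K \ S) disjoint_sdiff (w := fun _ => (#S : ℝ))
      (fun i hi => by
        rw [mem_sdiff] at hi
        simpa using card_nsmul_le_sum S _ 1
          fun j hj => hK i hi.1 j (hSK hj) fun hij => hi.2 (hij ▸ hj))
    have hstep : ∑ i ∈ K \ S, (#S : ℝ) * (D S - cliqueAge #K (#S + 1)) ≤
        ∑ i ∈ K \ S, (#S : ℝ) * (D S - D (insert i S)) := by
      refine sum_le_sum fun i hi => ?_
      have hi' := mem_sdiff.1 hi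
      have := h.le_cliqueAge hK (insert_nonempty i S) (insert_subset hi'.1 hSK)
      rw [card_insert_of_notMem hi'.2] at this
      gcongr
    rw [sum_const, nsmul_eq_mul, card_sdiff_of_subset hSK,
      Nat.cast_sub hlt.le] at hstep
    have hprod : 0 < (#S : ℝ) + #S * ((#K : ℝ) - #S) := by positivity
    refine le_of_mul_le_mul_left ?_ hprod
    linarith
termination_by #K - #S
decreasing_by
  rw [card_insert_of_notMem (mem_sdiff.1 hi).2]
  omega

lemma eq_cliqueAge (h : IsNormalizedAge a D) {K : Finset V}
    (hK : ∀ i ∈ K, ∀ j ∈ K, i ≠ j → a i j = 1) (hK0 : ∀ i ∉ K, ∀ j ∈ K, a i j = 0)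
    {S : Finset V} (hS : S.Nonempty) (hSK : S ⊆ K) :
    D S = cliqueAge #K #S := by
  have hpos : (0 : ℝ) < #S := by exact_mod_cast hS.card_pos
  have hb := h.balance S hS
  have hsub : K \ S ⊆ Sᶜ := fun i hi => mem_compl.2 (mem_sdiff.1 hi).2
  rw [← sum_subset hsub fun i hi hiK => by
    rw [sum_eq_zero fun j hj => hK0 i (fun hmem => hiK (mem_sdiff.2 ⟨hmem, mem_compl.1 hi⟩)) j
      (hSK hj), zero_mul]] at hb
  rcases (card_le_card hSK).eq_or_lt with heq | hlt
  · obtain rfl := eq_of_subset_of_card_le hSK heq.ge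
    rw [cliqueAge_self, eq_div_iff hpos.ne']
    simpa [mul_comm] using hb
  · have hrec := cliqueAge_rec hS.card_pos hlt
    have hlt' : (0 : ℝ) ≤ (#K : ℝ) - #S := by
      have : (#S : ℝ) < #K := by exact_mod_cast hlt
      linarith
    have hstep : ∑ i ∈ K \ S, (∑ j ∈ S, a i j) * (D S - D (insert i S)) =
        ∑ i ∈ K \ S, (#S : ℝ) * (D S - cliqueAge #K (#S + 1)) := by
      refine sum_congr rfl fun i hi => ?_
      have hi' := mem_sdiff.1 hi
      have := h.eq_cliqueAge hK hK0 (insert_nonempty i S) (insert_subset hi'.1 hSK)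
      rw [card_insert_of_notMem hi'.2] at this
      rw [this, sum_congr rfl fun j hj => hK i hi'.1 j (hSK hj) fun hij => hi'.2 (hij ▸ hj)]
      simp
    rw [hstep, sum_const, nsmul_eq_mul, card_sdiff_of_subset hSK, Nat.cast_sub hlt.le] at hb
    have hprod : 0 < (#S : ℝ) + #S * ((#K : ℝ) - #S) := by positivity
    refine mul_left_cancel₀ hprod.ne' ?_
    linarith
termination_by #K - #S
decreasing_by
  rw [card_insert_of_notMem (mem_sdiff.1 hi).2]
  omega

lemma singleton_le_one (h : IsNormalizedAge a D) (i : V) : D {i} ≤ 1 := by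
  simpa using h.card_mul_le_one (singleton_nonempty i)

lemma sum_singleton_clique_le (h : IsNormalizedAge a D) {K : Finset V}
    (hK : ∀ i ∈ K, ∀ j ∈ K, i ≠ j → 1 ≤ a i j) :
    ∑ i ∈ K, D {i} ≤ ∑ i ∈ Icc 1 #K, 1 / (i : ℝ) := by
  rw [← cliqueAge_one, ← nsmul_eq_mul, ← sum_const]
  refine sum_le_sum fun i hi => ?_
  simpa using h.le_cliqueAge hK (singleton_nonempty i) (singleton_subset_iff.2 hi)

lemma sum_singleton_le_card (h : IsNormalizedAge a D) (T : Finset V) :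
    ∑ i ∈ T, D {i} ≤ #T :=
  (sum_le_sum fun i _ => h.singleton_le_one i).trans (by simp)

end IsNormalizedAge

namespace IsCliqueExtension

open Finset

variable {V : Type*} [Fintype V] [DecidableEq V] {K W : Finset V} {k : ℕ}
  {x a : V → V → ℝ} {D : Finset V → ℝ}

lemma nonneg (e : IsCliqueExtension K W k x a) (i j : V) : 0 ≤ x i j := by
  rcases e.zero_or_one i j with h | h <;> simp [h]

lemma le_one (e : IsCliqueExtension K W k x a) (i j : V) : x i j ≤ 1 := by
  rcases e.zero_or_one i j with h | h <;> simp [h]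

lemma degree_eq (e : IsCliqueExtension K W k x a) (j : V) :
    ∑ i, x i j = ∑ i ∈ K, x i j + ∑ i ∈ W, x i j := by
  rw [← sum_union e.disj]
  refine (sum_subset (subset_univ _) fun i _ hi => ?_).symm
  rw [e.symm]
  exact not_not.1 fun h => hi (e.supp j i h)

lemma sum_degree (e : IsCliqueExtension K W k x a) :
    ∑ j ∈ K, ∑ i, x i j + ∑ j ∈ W, ∑ i, x i j = 2 * (k : ℝ) := by
  rw [← e.total, sum_comm (s := univ), ← sum_union e.disj]
  exact sum_subset (subset_univ _) fun j _ hj =>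
    sum_eq_zero fun i _ => not_not.1 fun h => hj (e.supp i j h)

lemma degree_of_mem_clique (e : IsCliqueExtension K W k x a) {u : V} (hu : u ∈ K) :
    ∑ i, x i u = ∑ w ∈ W, x w u := by
  rw [e.degree_eq, sum_eq_zero fun i hi => e.eq_zero_of_mem i hi u hu, zero_add]

lemma one_le_degree (e : IsCliqueExtension K W k x a) {w : V} (hw : w ∈ W) :
    1 ≤ ∑ i, x i w := by
  obtain ⟨i, hi⟩ := e.exists_link w hw
  rw [← hi]
  exact single_le_sum (f := fun i => x i w) (fun j _ => e.nonneg j w) (mem_univ i)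

lemma degree_le (e : IsCliqueExtension K W k x a) (w : V) : ∑ i, x i w ≤ k := by
  have h1 := e.total
  rw [← add_sum_erase _ _ (mem_univ w)] at h1
  have h2 : ∑ i ∈ univ.erase w, x i w ≤ ∑ i ∈ univ.erase w, ∑ j, x i j :=
    sum_le_sum fun i _ => single_le_sum (f := fun j => x i j) (fun j _ => e.nonneg i j) (mem_univ w)
  have h3 : ∑ i, x i w = ∑ i ∈ univ.erase w, x i w := by
    rw [← add_sum_erase _ _ (mem_univ w), e.diag, zero_add]
  have h4 : ∑ j, x w j = ∑ i, x i w := sum_congr rfl fun i _ => e.symm w i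
  linarith

lemma le_sum_degree (e : IsCliqueExtension K W k x a) : (k : ℝ) ≤ ∑ w ∈ W, ∑ i, x i w := by
  have h1 := e.sum_degree
  have h2 : ∑ j ∈ K, ∑ i, x i j ≤ ∑ w ∈ W, ∑ i, x i w := by
    rw [sum_congr rfl fun u hu => e.degree_of_mem_clique hu, sum_comm]
    refine sum_le_sum fun w _ => ?_
    rw [sum_congr rfl fun u _ => e.symm w u]
    exact sum_le_sum_of_subset_of_nonneg (subset_univ _) fun i _ _ => e.nonneg i w
  linarith

lemma card_le_sum_degree (e : IsCliqueExtension K W k x a) :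
    (#W : ℝ) ≤ ∑ w ∈ W, ∑ i, x i w := by
  simpa using sum_le_sum fun w hw => e.one_le_degree (w := w) hw

lemma gain_le (e : IsCliqueExtension K W k x a) (h : IsNormalizedAge a D) {w : V} (hw : w ∈ W)
    {p : ℝ} (hp1 : p ≤ 1) (hp : ∀ i, x i w = 1 → D {i, w} ≤ p) :
    (1 - p) * (1 / 2 + ((∑ i, x i w) - 1) / (2 * ((k : ℝ) + 1))) ≤ 1 - D {w} := by
  have hb := h.card_mul_add_sum_le (singleton_nonempty w) (T := univ.erase w)
    (w := fun i => x i w) (by simp) (fun i _ => by simpa using e.le_rate i w)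
  have hstep : ∑ i ∈ univ.erase w, x i w * (D {w} - p) ≤
      ∑ i ∈ univ.erase w, x i w * (D {w} - D {i, w}) := by
    refine sum_le_sum fun i _ => ?_
    rcases e.zero_or_one i w with h0 | h1
    · simp [h0]
    · have := hp i h1
      simp only [h1]
      linarith
  have hdeg : ∑ i, x i w = ∑ i ∈ univ.erase w, x i w := by
    rw [← add_sum_erase _ _ (mem_univ w), e.diag, zero_add]
  rw [← sum_mul, ← hdeg] at hstep
  rw [card_singleton, Nat.cast_one, one_mul] at hb
  have hd1 := e.one_le_degree hw
  have hdk := e.degree_le w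
  set d := ∑ i, x i w
  have hfrac : 1 / 2 + (d - 1) / (2 * ((k : ℝ) + 1)) ≤ d / (1 + d) := by
    have : d / (1 + d) = 1 / 2 + (d - 1) / (2 * (d + 1)) := by
      field_simp
      ring
    rw [this]
    gcongr
  have hmain : (1 - p) * (d / (1 + d)) ≤ 1 - D {w} := by
    rw [← mul_div_assoc, div_le_iff₀ (by linarith)]
    linarith
  exact (mul_le_mul_of_nonneg_left hfrac (by linarith)).trans hmain

lemma sum_outside_le (e : IsCliqueExtension K W k x a) (h : IsNormalizedAge a D)
    {p : ℝ} (hp1 : p ≤ 1) (hp : ∀ w ∈ W, ∀ i, x i w = 1 → D {i, w} ≤ p) :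
    ∑ w ∈ W, D {w} ≤ #W - (1 - p) *
      ((#W : ℝ) / 2 + ((∑ w ∈ W, ∑ i, x i w) - #W) / (2 * ((k : ℝ) + 1))) := by
  have hsum := sum_le_sum fun w hw => e.gain_le h hw hp1 (hp w hw)
  rw [← mul_sum, sum_add_distrib, ← sum_div, ← sum_div, sum_sub_distrib,
    sum_sub_distrib] at hsum
  simp only [sum_const, nsmul_eq_mul, mul_one] at hsum
  linarith

lemma sum_univ_le (e : IsCliqueExtension K W k x a) (h : IsNormalizedAge a D) :
    ∑ i, D {i} ≤ ∑ i ∈ K, D {i} + ∑ i ∈ W, D {i} + ((Fintype.card V : ℝ) - k - #W) := by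
  rw [← sum_add_sum_compl (K ∪ W), sum_union e.disj]
  gcongr
  refine (h.sum_singleton_le_card _).trans ?_
  rw [card_compl, Nat.cast_sub (card_le_univ _), card_union_of_disjoint e.disj, e.card_clique]
  push_cast
  linarith

lemma ne_of_link (e : IsCliqueExtension K W k x a) {i j : V} (hij : x i j = 1) : i ≠ j := by
  rintro rfl
  simp [e.diag] at hij

lemma pair_le_half (e : IsCliqueExtension K W k x a) (h : IsNormalizedAge a D) {i j : V}
    (hij : x i j = 1) : D {i, j} ≤ 1 / 2 := by
  have := h.card_mul_le_one (insert_nonempty i {j})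
  rw [card_pair (e.ne_of_link hij)] at this
  push_cast at this
  linarith

lemma sum_le_of_three_le (e : IsCliqueExtension K W k x a) (h : IsNormalizedAge a D)
    (hW : 3 ≤ #W) :
    ∑ i, D {i} ≤ ∑ i ∈ Icc 1 (k + 1), 1 / (i : ℝ) + ((Fintype.card V : ℝ) - k - 1) := by
  have h1 := e.sum_univ_le h
  have h2 := h.sum_singleton_clique_le e.rate_clique
  have h3 := e.sum_outside_le h (p := 1 / 2) (by norm_num) fun w _ i hi => e.pair_le_half h hi
  have h4 := e.le_sum_degree
  rw [e.card_clique] at h2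
  rw [sum_Icc_one_div_succ]
  have hW' : (3 : ℝ) ≤ #W := by exact_mod_cast hW
  have hk : (0 : ℝ) < (k : ℝ) := by exact_mod_cast e.pos
  have h5 : 2 * (1 - 1 / ((k : ℝ) + 1)) ≤
      (#W : ℝ) / 2 + ((∑ w ∈ W, ∑ i, x i w) - #W) / (2 * ((k : ℝ) + 1)) := by
    rw [← sub_nonneg]
    have : (#W : ℝ) / 2 + ((∑ w ∈ W, ∑ i, x i w) - #W) / (2 * ((k : ℝ) + 1))
        - 2 * (1 - 1 / ((k : ℝ) + 1)) =
        (k * (#W - 3) + ((∑ w ∈ W, ∑ i, x i w) - k)) / (2 * ((k : ℝ) + 1)) := by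
      field_simp
      ring
    rw [this]
    have : 0 ≤ (k : ℝ) * (#W - 3) := mul_nonneg hk.le (by linarith)
    exact div_nonneg (by linarith) (by positivity)
  linarith

lemma sum_le_of_card_eq_one (e : IsCliqueExtension K W k x a) (h : IsNormalizedAge a D)
    (hW : #W = 1) :
    ∑ i, D {i} ≤ ∑ i ∈ Icc 1 (k + 1), 1 / (i : ℝ) + ((Fintype.card V : ℝ) - k - 1) := by
  obtain ⟨w, rfl⟩ := card_eq_one.1 hW
  have hwK : w ∉ K := fun hw => disjoint_left.1 e.disj hw (mem_singleton_self w)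
  have hdeg := e.sum_degree
  rw [sum_congr rfl fun u hu => e.degree_of_mem_clique hu] at hdeg
  simp only [sum_singleton] at hdeg
  rw [e.degree_eq w, sum_singleton, e.diag, sum_congr rfl fun u _ => e.symm w u] at hdeg
  have hzero : ∑ u ∈ K, (1 - x u w) = 0 := by
    rw [sum_sub_distrib, sum_const, e.card_clique, nsmul_eq_mul]
    linarith
  rw [sum_eq_zero_iff_of_nonneg fun u _ => sub_nonneg.2 (e.le_one u w)] at hzero
  have hx : ∀ u ∈ K, x u w = 1 := fun u hu => by linarith [hzero u hu]
  have hclique : ∀ i ∈ insert w K, ∀ j ∈ insert w K, i ≠ j → 1 ≤ a i j := by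
    intro i hi j hj hij
    rcases mem_insert.1 hi with rfl | hiK <;> rcases mem_insert.1 hj with rfl | hjK
    · exact absurd rfl hij
    · exact (hx j hjK).symm.le.trans ((e.symm j i).le.trans (e.le_rate i j))
    · exact (hx i hiK).symm.le.trans (e.le_rate i j)
    · exact e.rate_clique i hiK j hjK hij
  have h1 := h.sum_singleton_clique_le hclique
  rw [card_insert_of_notMem hwK, e.card_clique, sum_insert hwK] at h1
  have h2 := e.sum_univ_le h
  rw [sum_singleton, card_singleton, Nat.cast_one] at h2
  linarith

lemma card_mul_le_cut (e : IsCliqueExtension K W k x a) (h : IsNormalizedAge a D)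
    (S : Finset V) :
    (#(K ∩ S) : ℝ) * (k - #(K ∩ S)) ≤ ∑ i ∈ (K ∪ W) \ S, ∑ j ∈ S, a i j := by
  have hcard : (k : ℝ) - #(K ∩ S) = #(K \ S) := by
    rw [← e.card_clique, ← card_inter_add_card_sdiff K S]
    push_cast
    ring
  rw [hcard, mul_comm, ← nsmul_eq_mul]
  refine (card_nsmul_le_sum (K \ S) (fun i => ∑ j ∈ S, a i j) _ fun i hi => ?_).trans
    (sum_le_sum_of_subset_of_nonneg (sdiff_subset_sdiff subset_union_left le_rfl)
      fun i _ _ => sum_nonneg fun j _ => h.rate_nonneg i j)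
  rw [mem_sdiff] at hi
  have hone : (#(K ∩ S) : ℝ) ≤ ∑ j ∈ K ∩ S, a i j := by
    simpa using card_nsmul_le_sum (K ∩ S) (fun j => a i j) 1 fun j hj =>
      e.rate_clique i hi.1 j (mem_inter.1 hj).1 fun hij => hi.2 (hij ▸ (mem_inter.1 hj).2)
  exact hone.trans (sum_le_sum_of_subset_of_nonneg inter_subset_right
    fun j _ _ => h.rate_nonneg i j)

lemma triple_le (e : IsCliqueExtension K W k x a) (h : IsNormalizedAge a D) (hW : #W = 2)
    {S : Finset V} (hS : #S = 3) (hSsub : S ⊆ K ∪ W) (hSK : (K ∩ S).Nonempty)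
    (hSW : (W ∩ S).Nonempty) : D S ≤ ((k : ℝ) + 3) / (4 * (k + 2)) := by
  have hk : (1 : ℝ) ≤ k := by exact_mod_cast e.pos
  have hSne : S.Nonempty := card_pos.1 (by omega)
  have hcardS : #(K ∩ S) + #(W ∩ S) = 3 := by
    rw [← hS, ← card_union_of_disjoint
      (e.disj.mono inter_subset_left inter_subset_left), ← union_inter_distrib_right,
      inter_eq_right.2 hSsub]
  have hpos := hSK.card_pos
  have hposW := hSW.card_pos
  have hcut : (k : ℝ) - 1 ≤ ∑ i ∈ (K ∪ W) \ S, ∑ j ∈ S, a i j := by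
    rcases (card_le_card (inter_subset_left (s₁ := K) (s₂ := S))).lt_or_eq with hlt | heq
    · refine le_trans ?_ (e.card_mul_le_cut h S)
      rw [e.card_clique] at hlt
      have h1 : (1 : ℝ) ≤ #(K ∩ S) := by exact_mod_cast hpos
      have h2 : (#(K ∩ S) : ℝ) + 1 ≤ k := by exact_mod_cast hlt
      nlinarith
    · rw [e.card_clique] at heq
      have hnn : 0 ≤ ∑ i ∈ (K ∪ W) \ S, ∑ j ∈ S, a i j :=
        sum_nonneg fun i _ => sum_nonneg fun j _ => h.rate_nonneg i j
      rcases (Nat.lt_or_ge k 2) with hk1 | hk2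
      · have : k = 1 := by omega
        subst this
        simpa using hnn
      · obtain rfl : k = 2 := by omega
        obtain ⟨v, hv, hvS⟩ : ∃ v ∈ W, v ∉ S := by
          by_contra! hall
          have : W ∩ S = W := inter_eq_left.2 hall
          rw [this] at hcardS
          omega
        obtain ⟨i, hi⟩ := e.exists_link v hv
        have hiKW : i ∈ K ∪ W := e.supp v i (by rw [e.symm, hi]; exact one_ne_zero)
        have hKWS : insert v S = K ∪ W := by
          refine eq_of_subset_of_card_le (insert_subset (mem_union_right _ hv) hSsub) ?_
          rw [card_insert_of_notMem hvS, card_union_of_disjoint e.disj, e.card_clique, hW, hS]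
        have hiS : i ∈ S := by
          rw [← hKWS] at hiKW
          exact (mem_insert.1 hiKW).resolve_left (e.ne_of_link hi)
        have h1 : (1 : ℝ) ≤ ∑ j ∈ S, a v j :=
          calc (1 : ℝ) = x v i := by rw [e.symm, hi]
            _ ≤ a v i := e.le_rate v i
            _ ≤ ∑ j ∈ S, a v j :=
              single_le_sum (f := fun j => a v j) (fun j _ => h.rate_nonneg v j) hiS
        have h2 : ∑ j ∈ S, a v j ≤ ∑ i ∈ (K ∪ W) \ S, ∑ j ∈ S, a i j :=
          single_le_sum (f := fun i => ∑ j ∈ S, a i j)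
            (fun i _ => sum_nonneg fun j _ => h.rate_nonneg i j)
            (mem_sdiff.2 ⟨mem_union_right _ hv, hvS⟩)
        push_cast
        linarith
  have hb := h.card_add_mul_le hSne (disjoint_sdiff (t := K ∪ W)) (q := 1 / 4)
    (by linarith) hcut fun i hi => by
      have := h.card_mul_le_one (insert_nonempty i S)
      rw [card_insert_of_notMem (mem_sdiff.1 hi).2, hS] at this
      push_cast at this
      linarith
  rw [hS] at hb
  push_cast at hb
  rw [le_div_iff₀ (by linarith)]
  linarith

lemma pair_le (e : IsCliqueExtension K W k x a) (h : IsNormalizedAge a D) (hW : #W = 2)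
    {i w : V} (hw : w ∈ W) (hiw : x i w = 1) : D {i, w} ≤ ((k : ℝ) + 5) / (4 * (k + 2)) := by
  have hk : (1 : ℝ) ≤ k := by exact_mod_cast e.pos
  have hne := e.ne_of_link hiw
  have hi : i ∈ K ∪ W := e.supp w i (by rw [e.symm, hiw]; exact one_ne_zero)
  have hsub : ({i, w} : Finset V) ⊆ K ∪ W :=
    insert_subset hi (singleton_subset_iff.2 (mem_union_right _ hw))
  have key : (k : ℝ) - 1 ≤ ∑ t ∈ (K ∪ W) \ {i, w}, ∑ j ∈ {i, w}, a t j ∧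
      ∀ t ∈ (K ∪ W) \ {i, w}, (K ∩ insert t {i, w}).Nonempty := by
    rcases mem_union.1 hi with hiK | hiW
    · refine ⟨le_trans ?_ (e.card_mul_le_cut h {i, w}), fun t _ => ⟨i, by simp [hiK]⟩⟩
      have hwK : w ∉ K := disjoint_right.1 e.disj hw
      have : K ∩ {i, w} = {i} := by
        ext j
        simp only [mem_inter, mem_insert, mem_singleton]
        constructor
        · rintro ⟨hj, rfl | rfl⟩
          · rfl
          · exact absurd hj hwK
        · rintro rfl
          exact ⟨hiK, Or.inl rfl⟩
      rw [this]
      simp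
    · have hWeq : W = {i, w} := by
        refine (eq_of_subset_of_card_le
          (insert_subset hiW (singleton_subset_iff.2 hw)) ?_).symm
        rw [hW, card_pair hne]
      have hdiff : (K ∪ W) \ {i, w} = K := by
        rw [← hWeq, union_sdiff_cancel_right e.disj]
      rw [hdiff]
      refine ⟨?_, fun t ht => ⟨t, by simp [ht]⟩⟩
      have hdeg := e.sum_degree
      rw [sum_congr rfl fun u hu => e.degree_of_mem_clique hu, hWeq] at hdeg
      simp only [sum_pair hne] at hdeg
      rw [e.degree_eq i, e.degree_eq w, hWeq, sum_pair hne, sum_pair hne, e.diag, e.diag,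
        e.symm w i, hiw, sum_congr rfl fun u _ => congrArg₂ (· + ·) (e.symm i u) (e.symm w u),
        sum_add_distrib] at hdeg
      have hle : ∑ t ∈ K, (x t i + x t w) ≤ ∑ t ∈ K, ∑ j ∈ {i, w}, a t j :=
        sum_le_sum fun t _ => by
          rw [sum_pair hne]
          exact add_le_add (e.le_rate t i) (e.le_rate t w)
      rw [sum_add_distrib] at hle
      linarith
  have hb := h.card_add_mul_le (insert_nonempty i {w}) disjoint_sdiff
    (q := ((k : ℝ) + 3) / (4 * (k + 2))) (by linarith) key.1 fun t ht => by
      refine e.triple_le h hW ?_ (insert_subset (mem_sdiff.1 ht).1 hsub) (key.2 t ht)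
        ⟨w, by simp [hw]⟩
      rw [card_insert_of_notMem (mem_sdiff.1 ht).2, card_pair hne]
  rw [card_pair hne] at hb
  push_cast at hb
  have hid : 1 + ((k : ℝ) - 1) * ((k + 3) / (4 * (k + 2))) =
      (2 + (k - 1)) * ((k + 5) / (4 * (k + 2))) := by
    field_simp
    ring
  rw [hid] at hb
  exact le_of_mul_le_mul_left hb (by linarith)

lemma clique_singleton_le (e : IsCliqueExtension K W k x a) (h : IsNormalizedAge a D)
    (hW : #W = 2) (hk : 2 ≤ k) {p : ℝ} (hp : ∀ w ∈ W, ∀ i, x i w = 1 → D {i, w} ≤ p)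
    (hpc : p ≤ cliqueAge k 1) {u : V} (hu : u ∈ K) :
    D {u} ≤ cliqueAge k 1 - (∑ i, x i u) * ((cliqueAge k 1 - p) / (k + 2)) := by
  have hb := h.card_mul_add_sum_le (singleton_nonempty u) (T := univ.erase u)
    (w := fun i => (if i ∈ K then 1 else 0) + x i u) (by simp) fun i hi => by
      rw [sum_singleton]
      split_ifs with hiK
      · rw [e.eq_zero_of_mem i hiK u hu, add_zero]
        exact e.rate_clique i hiK u hu (ne_of_mem_erase hi)
      · rw [zero_add]
        exact e.le_rate i u
  have hstep : ∑ i ∈ univ.erase u, ((if i ∈ K then 1 else 0) * (D {u} - cliqueAge k 2)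
        + x i u * (D {u} - p)) ≤
      ∑ i ∈ univ.erase u, ((if i ∈ K then 1 else 0) + x i u) * (D {u} - D {i, u}) := by
    refine sum_le_sum fun i hi => ?_
    have hiu := ne_of_mem_erase hi
    rw [add_mul]
    refine add_le_add ?_ ?_
    · split_ifs with hiK
      · have := h.le_cliqueAge e.rate_clique (insert_nonempty i {u})
          (insert_subset hiK (singleton_subset_iff.2 hu))
        rw [card_pair hiu, e.card_clique] at this
        linarith
      · simp
    · rcases e.zero_or_one i u with h0 | h1
      · simp [h0]
      · have hx : x u i = 1 := by rw [e.symm, h1]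
        have hiW : i ∈ W := by
          refine (mem_union.1 (e.supp u i (by simp [hx]))).resolve_left fun hiK => ?_
          simp [e.eq_zero_of_mem u hu i hiK] at hx
        have := hp i hiW u hx
        rw [pair_comm] at this
        rw [h1]
        linarith
  have hdeg : ∑ i, x i u = ∑ i ∈ univ.erase u, x i u := by
    rw [← add_sum_erase _ _ (mem_univ u), e.diag, zero_add]
  have hind : ∑ i ∈ univ.erase u, (if i ∈ K then (1 : ℝ) else 0) = k - 1 := by
    have := add_sum_erase univ (fun i => if i ∈ K then (1 : ℝ) else 0) (mem_univ u)
    simp only [hu, if_true, sum_boole, filter_mem_eq_inter, univ_inter, e.card_clique] at this ⊢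
    linarith
  rw [sum_add_distrib, ← sum_mul, ← sum_mul, hind, ← hdeg] at hstep
  rw [card_singleton, Nat.cast_one, one_mul] at hb
  have hd2 : ∑ i, x i u ≤ 2 := by
    rw [e.degree_of_mem_clique hu]
    refine (sum_le_sum fun w _ => e.le_one w u).trans ?_
    simp [hW]
  have hd0 : 0 ≤ ∑ i, x i u := sum_nonneg fun i _ => e.nonneg i u
  have hrec := cliqueAge_rec one_pos hk
  have hkpos : (0 : ℝ) < k := by exact_mod_cast e.pos
  set d := ∑ i, x i u
  set c := cliqueAge k 1
  push_cast at hrec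
  have hmain : (k + d) * (D {u} - c) ≤ -(d * (c - p)) := by linarith
  set g := (c - p) / (k + 2) with hg
  have hg0 : 0 ≤ g := div_nonneg (by linarith) (by linarith)
  have hcp : c - p = g * (k + 2) := by rw [hg, div_mul_cancel₀ _ (by linarith)]
  rw [hcp] at hmain
  have : (k + d) * (D {u} - c) ≤ (k + d) * (-(d * g)) := by
    have : 0 ≤ d * g * (2 - d) := mul_nonneg (mul_nonneg hd0 hg0) (by linarith)
    linarith
  have := le_of_mul_le_mul_left this (by linarith)
  linarith

lemma sum_le_of_card_eq_two (e : IsCliqueExtension K W k x a) (h : IsNormalizedAge a D)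
    (hW : #W = 2) :
    ∑ i, D {i} ≤ ∑ i ∈ Icc 1 (k + 1), 1 / (i : ℝ) + ((Fintype.card V : ℝ) - k - 1) := by
  have h1 := e.sum_univ_le h
  have h2 := h.sum_singleton_clique_le e.rate_clique
  have hk : (1 : ℝ) ≤ (k : ℝ) := by exact_mod_cast e.pos
  have hp1 : ((k : ℝ) + 5) / (4 * (k + 2)) ≤ 1 := by
    rw [div_le_one (by linarith)]
    linarith
  have hp : ∀ w ∈ W, ∀ i, x i w = 1 → D {i, w} ≤ ((k : ℝ) + 5) / (4 * (k + 2)) :=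
    fun w hw i hi => e.pair_le h hW hw hi
  have h3 := e.sum_outside_le h hp1 hp
  have h4 := e.le_sum_degree
  have h5 := e.card_le_sum_degree
  have h6 := e.sum_degree
  rw [e.card_clique] at h2
  rw [sum_Icc_one_div_succ]
  have hclique (hk2 : 2 ≤ k) (hpc : ((k : ℝ) + 5) / (4 * (k + 2)) ≤ cliqueAge k 1) :
      ∑ u ∈ K, D {u} ≤ (k : ℝ) * cliqueAge k 1 - (∑ u ∈ K, ∑ i, x i u) *
        ((cliqueAge k 1 - ((k : ℝ) + 5) / (4 * (k + 2))) / (k + 2)) := by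
    have := sum_le_sum fun u hu => e.clique_singleton_le h hW hk2 hp hpc (u := u) hu
    rw [sum_sub_distrib, ← sum_mul, sum_const, nsmul_eq_mul, e.card_clique] at this
    exact this
  rw [hW] at h1 h3 h5
  push_cast at h1 h3 h5
  generalize ∑ w ∈ W, ∑ i, x i w = s at *
  obtain hs : ∑ u ∈ K, ∑ i, x i u = 2 * k - s := by linarith
  rw [hs] at hclique
  rcases Nat.lt_or_ge k 7 with hk7 | hk7
  · have hkpos := e.pos
    have hage : cliqueAge k 1 = (∑ i ∈ Icc 1 k, 1 / (i : ℝ)) / k := by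
      rw [← cliqueAge_one, mul_div_cancel_left₀ _ (by linarith)]
    interval_cases k
    · norm_num at *
      linarith
    all_goals
      norm_num [sum_Icc_succ_top] at hage
      have hc := hclique (by norm_num) (by rw [hage]; norm_num)
      rw [hage] at hc
      norm_num [sum_Icc_succ_top] at *
      linarith
  · have hk7' : (7 : ℝ) ≤ k := by exact_mod_cast hk7
    have h7 : (1 : ℝ) - 1 / (k + 1) ≤
        (1 - (k + 5) / (4 * (k + 2))) * (2 / 2 + (k - 2) / (2 * (k + 1))) := by
      rw [← sub_nonneg]
      have : (1 - ((k : ℝ) + 5) / (4 * (k + 2))) * (2 / 2 + (k - 2) / (2 * (k + 1)))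
          - (1 - 1 / (k + 1)) = (k * (k - 7)) / (8 * ((k + 2) * (k + 1))) := by
        field_simp
        ring
      rw [this]
      have : (0 : ℝ) ≤ k - 7 := by linarith
      positivity
    have h8 : (1 - ((k : ℝ) + 5) / (4 * (k + 2))) * (2 / 2 + (k - 2) / (2 * (k + 1))) ≤
        (1 - (k + 5) / (4 * (k + 2))) * (2 / 2 + (s - 2) / (2 * (k + 1))) := by
      have := sub_nonneg.2 hp1
      gcongr
    linarith

lemma sum_le (e : IsCliqueExtension K W k x a) (h : IsNormalizedAge a D) :
    ∑ i, D {i} ≤ ∑ i ∈ Icc 1 (k + 1), 1 / (i : ℝ) + ((Fintype.card V : ℝ) - k - 1) := by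
  have hW : #W ≠ 0 := fun h0 => by
    have h1 := e.le_sum_degree
    rw [card_eq_zero.1 h0, sum_empty] at h1
    exact e.pos.ne' (by exact_mod_cast h1.antisymm k.cast_nonneg)
  obtain h1 | h2 | h3 : #W = 1 ∨ #W = 2 ∨ 3 ≤ #W := by omega
  · exact e.sum_le_of_card_eq_one h h1
  · exact e.sum_le_of_card_eq_two h h2
  · exact e.sum_le_of_three_le h h3

end IsCliqueExtension

open Finset in
lemma IsYatesAge.isNormalizedAge {V : Type*} [Fintype V] [DecidableEq V] {lamS r : ℝ}
    {lam : V → V → ℝ} {Δ : Finset V → ℝ} (hS : 0 < lamS) (hr : 0 < r)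
    (hlam : ∀ i j, 0 ≤ lam i j) (hΔ : IsYatesAge lamS (fun _ => r) lam Δ)
    (hmono : ∀ S T : Finset V, S.Nonempty → S ⊆ T → Δ T ≤ Δ S) :
    IsNormalizedAge (fun i j => lam i j / r) (fun S => Δ S * (r / lamS)) where
  rate_nonneg i j := div_nonneg (hlam i j) hr.le
  anti S T hST h := mul_le_mul_of_nonneg_right (hmono S T hST h) (div_pos hr hS).le
  balance S hne := by
    have h := hΔ S hne
    have hcard : (0 : ℝ) < #S := by exact_mod_cast hne.card_pos
    have hcut : 0 ≤ ∑ i ∈ Sᶜ, ∑ j ∈ S, lam i j :=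
      sum_nonneg fun i _ => sum_nonneg fun j _ => hlam i j
    rw [sum_const, nsmul_eq_mul, eq_div_iff (by positivity)] at h
    have hsum : ∑ i ∈ Sᶜ, (∑ j ∈ S, lam i j / r) *
          (Δ S * (r / lamS) - Δ (insert i S) * (r / lamS)) =
        (Δ S * (∑ i ∈ Sᶜ, ∑ j ∈ S, lam i j) -
          ∑ i ∈ Sᶜ, (∑ j ∈ S, lam i j) * Δ (insert i S)) / lamS := by
      rw [mul_sum, ← sum_sub_distrib, sum_div]
      refine sum_congr rfl fun i _ => ?_
      rw [← sum_div]
      field_simp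
    rw [hsum]
    field_simp
    linarith

namespace IsNormalizedAge

open Finset

variable {V : Type*} [Fintype V] [DecidableEq V] {a : V → V → ℝ} {D : Finset V → ℝ}

lemma sum_singleton_eq_of_clique (h : IsNormalizedAge a D) {K : Finset V}
    (hK : ∀ i ∈ K, ∀ j ∈ K, i ≠ j → a i j = 1)
    (hK0 : ∀ i j, i ∉ K ∨ j ∉ K → a i j = 0) :
    ∑ i, D {i} = ∑ i ∈ Icc 1 #K, 1 / (i : ℝ) + ((Fintype.card V : ℝ) - #K) := by
  rw [← sum_add_sum_compl K, ← cliqueAge_one]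
  congr 1
  · rw [← nsmul_eq_mul, ← sum_const]
    refine sum_congr rfl fun i hi => ?_
    simpa using h.eq_cliqueAge hK (fun i hi j _ => hK0 i j (Or.inl hi)) (singleton_nonempty i)
      (singleton_subset_iff.2 hi)
  · rw [← Nat.cast_sub (card_le_univ _), ← card_compl, card_eq_sum_ones]
    push_cast
    refine sum_congr rfl fun i hi => ?_
    have := h.eq_cliqueAge (K := {i}) (S := {i})
      (fun j hj l hl hjl => absurd ((mem_singleton.1 hj).trans (mem_singleton.1 hl).symm) hjl)
      (fun j _ l hl => hK0 j l (Or.inr (by rw [mem_singleton.1 hl]; exact mem_compl.1 hi)))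
      (singleton_nonempty i) le_rfl
    rw [this, cliqueAge_self]
    simp

end IsNormalizedAge

open Finset in
lemma sum_sum_indicator_mem_eq {V : Type*} [Fintype V] [DecidableEq V] {E : Finset (Sym2 V)}
    (hE : ∀ e ∈ E, ¬ e.IsDiag) :
    ∑ i, ∑ j, (if s(i, j) ∈ E then (1 : ℝ) else 0) = 2 * #E := by
  classical
  obtain ⟨G, hGdef⟩ : ∃ G, G = SimpleGraph.fromEdgeSet (E : Set (Sym2 V)) := ⟨_, rfl⟩
  have hG : G.edgeFinset = E := by
    ext e
    rw [SimpleGraph.mem_edgeFinset, hGdef, SimpleGraph.edgeSet_fromEdgeSet]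
    exact ⟨fun h => h.1, fun h => ⟨h, hE e h⟩⟩
  have hdeg (i : V) : ∑ j, (if s(i, j) ∈ E then (1 : ℝ) else 0) = G.degree i := by
    rw [sum_boole, ← SimpleGraph.card_neighborFinset_eq_degree,
      SimpleGraph.neighborFinset_eq_filter]
    congr 2
    ext j
    simp only [mem_filter, mem_univ, true_and]
    rw [← SimpleGraph.mem_edgeSet, ← SimpleGraph.mem_edgeFinset, hG]
  have h := G.sum_degrees_eq_twice_card_edges
  rw [hG] at h
  simp only [hdeg]
  exact_mod_cast h

open Finset in
lemma isCliqueExtension_of_edges {V : Type*} [Fintype V] [DecidableEq V] {K : Finset V} {k : ℕ}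
    (hK : #K = k) (hk : 0 < k) {E : Finset (Sym2 V)} (hEcard : #E = k)
    (hEnodiag : ∀ e ∈ E, ¬ e.IsDiag) (hEout : ∀ e ∈ E, ¬ ∀ v ∈ e, v ∈ K) :
    IsCliqueExtension K (univ.filter fun w => w ∉ K ∧ ∃ i, s(i, w) ∈ E) k
      (fun i j => if s(i, j) ∈ E then 1 else 0)
      (fun i j => if (i ≠ j ∧ i ∈ K ∧ j ∈ K) ∨ s(i, j) ∈ E then 1 else 0) where
  card_clique := hK
  pos := hk
  disj := disjoint_left.2 fun w hw hw' => (mem_filter.1 hw').2.1 hw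
  symm i j := by simp only [Sym2.eq_swap]
  zero_or_one i j := by
    split_ifs <;> simp
  diag i := if_neg fun h => hEnodiag _ h (Sym2.mk_isDiag_iff.2 rfl)
  eq_zero_of_mem i hi j hj := if_neg fun h => hEout _ h fun v hv => by
    rcases Sym2.mem_iff.1 hv with rfl | rfl <;> assumption
  supp i j h := by
    have hij : s(i, j) ∈ E := by
      by_contra hn
      exact h (if_neg hn)
    by_cases hj : j ∈ K
    · exact mem_union_left _ hj
    · exact mem_union_right _ (mem_filter.2 ⟨mem_univ _, hj, i, hij⟩)
  exists_link w hw := by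
    obtain ⟨i, hi⟩ := (mem_filter.1 hw).2.2
    exact ⟨i, if_pos hi⟩
  total := by rw [sum_sum_indicator_mem_eq hEnodiag, hEcard]
  rate_clique i hi j hj hij := (if_pos (Or.inl ⟨hij, hi, hj⟩)).ge
  le_rate i j := by
    split_ifs with h1 h2 <;> simp_all

/-- **greedy step.** Start from a network of `n` nodes whose first `k`
nodes form a mini-FC (all internal rates `lam/n`) and whose other nodes are isolated, and
add `k` new links `E`, none internal to the mini-FC.  Then for any set-monotone Yates age
function `ΔBar` of the augmented network, the total network age satisfies
`Σ_i ΔBar {i} ≤ (lamS/lam)·(n·Σ_{j=1}^{k+1} 1/j + n·(n−k−1))`, with equality when `E`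
connects a single node outside the mini-FC to all of its `k` nodes (producing a mini-FC of
`k+1` nodes and `n−k−1` isolated nodes). -/
theorem greedy_step_maximizes_total_age
    (lamS lam : ℝ) (hlamS : 0 < lamS) (hlam : 0 < lam)
    (n k : ℕ) (hk : 0 < k) (hkn : k + 1 ≤ n)
    (E : Finset (Sym2 (Fin n))) (hEcard : E.card = k)
    (hEnodiag : ∀ e ∈ E, ¬ e.IsDiag)
    (hEout : ∀ e ∈ E, ¬ (∀ x ∈ e, x.val < k))
    (lamBar : Fin n → Fin n → ℝ)
    (hlamBar : ∀ i j : Fin n,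
      lamBar i j = if (i ≠ j ∧ i.val < k ∧ j.val < k) ∨ s(i, j) ∈ E then lam / n else 0)
    (ΔBar : Finset (Fin n) → ℝ)
    (hΔBar : IsYatesAge lamS (fun _ => lam / n) lamBar ΔBar)
    (hmono : ∀ S T : Finset (Fin n), S.Nonempty → S ⊆ T → ΔBar T ≤ ΔBar S) :
    (∑ i : Fin n, ΔBar {i}) ≤
      (lamS / lam) * ((n : ℝ) * (∑ j ∈ Finset.Icc 1 (k + 1), (1 / (j : ℝ)))
        + (n : ℝ) * ((n : ℝ) - (k : ℝ) - 1))
    ∧ ((∃ v : Fin n, k ≤ v.val ∧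
          E = (Finset.univ.filter (fun j : Fin n => j.val < k)).image (fun j => s(v, j))) →
        (∑ i : Fin n, ΔBar {i}) =
          (lamS / lam) * ((n : ℝ) * (∑ j ∈ Finset.Icc 1 (k + 1), (1 / (j : ℝ)))
            + (n : ℝ) * ((n : ℝ) - (k : ℝ) - 1))) := by
  have hn : (0 : ℝ) < n := by exact_mod_cast (by omega : 0 < n)
  have hr : 0 < lam / n := div_pos hlam hn
  set K : Finset (Fin n) := Finset.univ.filter fun j => j.val < k with hKdef
  have hmemK (i : Fin n) : i ∈ K ↔ i.val < k := by simp [K]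
  have hKcard : K.card = k := by
    rw [hKdef, Fin.card_filter_val_lt, min_eq_right (by omega)]
  have h := hΔBar.isNormalizedAge hlamS hr
    (fun i j => by rw [hlamBar]; split_ifs <;> simp [hr.le]) hmono
  have ha : (fun i j => lamBar i j / (lam / n)) =
      fun i j => if (i ≠ j ∧ i ∈ K ∧ j ∈ K) ∨ s(i, j) ∈ E then (1 : ℝ) else 0 := by
    ext i j
    simp only [hlamBar, hmemK]
    split_ifs <;> simp [hr.ne']
  rw [ha] at h
  have hscale : ∑ i : Fin n, ΔBar {i} =
      lamS / lam * (n * ∑ i : Fin n, ΔBar {i} * (lam / n / lamS)) := by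
    rw [← Finset.sum_mul]
    field_simp
  rw [hscale, ← mul_add]
  constructor
  · have hle := (isCliqueExtension_of_edges hKcard hk hEcard hEnodiag
      (by simpa only [hmemK] using hEout)).sum_le h
    rw [Fintype.card_fin] at hle
    gcongr
  · rintro ⟨v, hv, hE⟩
    have hvK : v ∉ K := by rw [hmemK]; omega
    have hmemE (i j : Fin n) : s(i, j) ∈ E ↔ (i = v ∧ j ∈ K) ∨ (j = v ∧ i ∈ K) := by
      rw [hE, Finset.mem_image]
      constructor
      · rintro ⟨l, hl, hlij⟩
        rcases Sym2.eq_iff.1 hlij with ⟨rfl, rfl⟩ | ⟨rfl, rfl⟩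
        · exact Or.inl ⟨rfl, hl⟩
        · exact Or.inr ⟨rfl, hl⟩
      · rintro (⟨rfl, hj⟩ | ⟨rfl, hi⟩)
        · exact ⟨j, hj, rfl⟩
        · exact ⟨i, hi, Sym2.eq_swap⟩
    have heq := h.sum_singleton_eq_of_clique (K := insert v K)
      (fun i hi j hj hij => if_pos (by
        rw [Finset.mem_insert] at hi hj
        rw [hmemE]
        grind))
      (fun i j hij => if_neg (by
        rw [Finset.mem_insert, Finset.mem_insert] at hij
        rw [hmemE]
        grind))
    rw [Finset.card_insert_of_notMem hvK, hKcard, Fintype.card_fin] at heq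
    rw [heq]
    push_cast
    ring
end

section
/- Fix a positive integer n and a real λ_s > 0, λ > 0. Let k, k̄ be integers with k ≥ k̄ ≥ 2, and let m̄ be a real number with m̄ ≥ 1 satisfying m̄·k̄·(k̄ − 1) = k·(k − 1) (equal total number of links) and m̄·k̄ ≤ n. Then the total network age of m̄ clusters of size-k̄ mini-FCs plus the remaining isolated nodes does not exceed that of a single size-k mini-FC plus isolated nodes: (λ_s/λ)·( m̄·k̄·(n/k̄)·Σ_{j=1}^{k̄} 1/j + (n − m̄·k̄)·n ) ≤ (λ_s/λ)·( n·Σ_{j=1}^{k} 1/j + (n − k)·n ). That is, consolidation of all links into one big mini-FC results in higher total network age than grouping the same number of links into multiple smaller mini-FCs. -/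
/-- The harmonic deficit `k - H_k` is at least `k(k-1) / (2(k+1))`. -/
theorem mul_sub_one_div_le_sub_sum_one_div (k : ℕ) (hk : 1 ≤ k) :
    (k : ℝ) * (k - 1) / (2 * (k + 1)) ≤ k - ∑ j ∈ Finset.Icc 1 k, (1 / (j : ℝ)) := by
  induction k, hk using Nat.le_induction with
  | base => simp
  | succ k hk ih =>
    rw [Finset.sum_Icc_succ_top (by omega)]
    push_cast
    have hk0 : (0 : ℝ) ≤ k := k.cast_nonneg
    have h : (k : ℝ) * (k - 1) / (2 * (k + 1)) + (1 - 1 / (k + 1)) = k / 2 := by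
      field_simp
      ring
    have h' : ((k : ℝ) + 1) * (k + 1 - 1) / (2 * (k + 1 + 1)) ≤ k / 2 := by
      rw [div_le_div_iff₀ (by positivity) (by positivity)]
      nlinarith
    linarith

/-- The ratio `(k - H_k) / (k(k-1))` is antitone on `k ≥ 2`, in cross-multiplied form. -/
theorem sub_sum_one_div_mul_le {a k : ℕ} (ha : 2 ≤ a) (hak : a ≤ k) :
    ((k : ℝ) - ∑ j ∈ Finset.Icc 1 k, (1 / (j : ℝ))) * (a * (a - 1)) ≤
      ((a : ℝ) - ∑ j ∈ Finset.Icc 1 a, (1 / (j : ℝ))) * (k * (k - 1)) := by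
  have ha' : (2 : ℝ) ≤ a := by exact_mod_cast ha
  have hc : (0 : ℝ) ≤ a * (a - 1) := mul_nonneg (by linarith) (by linarith)
  induction k, hak using Nat.le_induction with
  | base => exact le_rfl
  | succ k hk ih =>
    have hk' : (2 : ℝ) ≤ k := by exact_mod_cast ha.trans hk
    have hD := mul_sub_one_div_le_sub_sum_one_div k (by omega)
    rw [Finset.sum_Icc_succ_top (by omega)]
    push_cast
    generalize ∑ j ∈ Finset.Icc 1 k, (1 / (j : ℝ)) = H at *
    generalize (a : ℝ) - ∑ j ∈ Finset.Icc 1 a, (1 / (j : ℝ)) = A at *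
    generalize (a : ℝ) * (a - 1) = c at *
    have hstep : ((k : ℝ) - 1) * (k + 1 - (H + 1 / (k + 1))) ≤ (k + 1) * (k - H) := by
      have h : ((k : ℝ) - 1) * (1 - 1 / (k + 1)) = 2 * (k * (k - 1) / (2 * (k + 1))) := by
        field_simp
        ring
      linarith
    refine le_of_mul_le_mul_left ?_ (by linarith : (0 : ℝ) < k - 1)
    have h₁ := mul_le_mul_of_nonneg_right hstep hc
    have h₂ := mul_le_mul_of_nonneg_left ih (by linarith : (0 : ℝ) ≤ k + 1)
    linarith


/-- Consolidation of all links into one big mini-FC results in higher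
total network age than grouping the same number of links into multiple smaller mini-FCs:
if `m̄ · k̄(k̄−1) = k(k−1)` (equal number of links) with `k ≥ k̄ ≥ 2`, `m̄ ≥ 1` and
`m̄·k̄ ≤ n`, then the total age of `m̄` size-`k̄` mini-FCs plus isolated nodes is at most
that of one size-`k` mini-FC plus isolated nodes. -/
theorem consolidation_maximizes_total_age
    (lamS lam : ℝ) (hlamS : 0 < lamS) (hlam : 0 < lam)
    (n : ℕ) (hn : 0 < n)
    (k kbar : ℕ) (hkbar2 : 2 ≤ kbar) (hkk : kbar ≤ k)
    (mbar : ℝ) (hmbar : 1 ≤ mbar)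
    (hlinks : mbar * (kbar : ℝ) * ((kbar : ℝ) - 1) = (k : ℝ) * ((k : ℝ) - 1))
    (hfit : mbar * (kbar : ℝ) ≤ (n : ℝ)) :
    (lamS / lam) * (mbar * (kbar : ℝ) * ((n : ℝ) / (kbar : ℝ)) *
        (∑ j ∈ Finset.Icc 1 kbar, (1 / (j : ℝ)))
      + ((n : ℝ) - mbar * (kbar : ℝ)) * (n : ℝ))
    ≤ (lamS / lam) * ((n : ℝ) * (∑ j ∈ Finset.Icc 1 k, (1 / (j : ℝ)))
      + ((n : ℝ) - (k : ℝ)) * (n : ℝ)) := by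
  have hb : (2 : ℝ) ≤ kbar := by exact_mod_cast hkbar2
  have hmono := sub_sum_one_div_mul_le hkbar2 hkk
  rw [← hlinks] at hmono
  have hcancel : mbar * (kbar : ℝ) * ((n : ℝ) / kbar) = mbar * n := by
    field_simp
  rw [hcancel]
  generalize ∑ j ∈ Finset.Icc 1 kbar, (1 / (j : ℝ)) = B at *
  generalize ∑ j ∈ Finset.Icc 1 k, (1 / (j : ℝ)) = H at *
  have hdeficit : (k : ℝ) - H ≤ mbar * (kbar - B) := by
    refine le_of_mul_le_mul_right ?_ (mul_pos (by linarith) (by linarith) :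
      (0 : ℝ) < kbar * (kbar - 1))
    linarith
  refine mul_le_mul_of_nonneg_left ?_ (div_pos hlamS hlam).le
  have := mul_le_mul_of_nonneg_left hdeficit (n.cast_nonneg : (0 : ℝ) ≤ n)
  linarith
end

section
/- Fix reals λ_s > 0, λ > 0 and c > 0, and define for positive integers n ≥ k ≥ 1 the greedy-configuration average age Δavg(n,k) = (λ_s/λ)·( Σ_{j=1}^{k} 1/j + (n − k) ). Then there exist a constant C > 0 and a positive integer N such that for all integers n ≥ N and all integers ñ with 0 ≤ ñ ≤ c·n·log n, taking k to be the largest positive integer with k·(k−1)/2 ≤ n·(n−1)/2 − ñ, one has Δavg(n,k) ≤ C·(λ_s/λ)·log n. That is, a fully connected network of n nodes with ñ = O(n·log n) jammers placed according to the greedy approach still has average version age O(log n). -/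
/-- Average version age of the greedy jammed configuration of a fully connected network of
`n` nodes: one mini-FC of `k` nodes plus `n − k` isolated nodes, giving
`Δavg(n,k) = (lamS/lam)·(Σ_{j=1}^{k} 1/j + (n − k))`. -/
noncomputable def greedyAvgAge (lamS lam : ℝ) (n k : ℕ) : ℝ :=
  (lamS / lam) * ((∑ j ∈ Finset.Icc 1 k, (1 / (j : ℝ))) + ((n : ℝ) - (k : ℝ)))

/-- If `k + 1` nodes are too many for a mini-FC built from `n(n-1)/2 - m` links, and
`m ≤ x n`, then at most `2x + 1` nodes are isolated. -/
lemma isolated_le_of_links_lt {n m k : ℕ} {x : ℝ} (hn : 0 < n) (hx : 0 ≤ x)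
    (hm : (m : ℝ) ≤ x * n)
    (h : n * (n - 1) / 2 - m < (k + 1) * k / 2) :
    (n : ℝ) - k ≤ 2 * x + 1 := by
  have h_nat : n * (n - 1) ≤ (k + 1) * k + 2 * m := by omega
  have h_real : (n : ℝ) * (n - 1) ≤ (k + 1) * k + 2 * m := by
    have := (Nat.cast_le (α := ℝ)).mpr h_nat
    push_cast [Nat.cast_sub (Nat.one_le_iff_ne_zero.mpr hn.ne')] at this
    exact this
  have hn' : (0 : ℝ) < n := by exact_mod_cast hn
  have hk : (0 : ℝ) ≤ k := k.cast_nonneg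
  by_contra! hlt
  have h1 : 0 ≤ ((n : ℝ) - k - 1) * k := mul_nonneg (by linarith) hk
  have h2 : 2 * x * n < ((n : ℝ) - k - 1) * n := mul_lt_mul_of_pos_right (by linarith) hn'
  nlinarith

/-- A complete graph with no more links than the one on `n ≥ 1` nodes has at most `n` nodes. -/
lemma le_of_links_le {n k : ℕ} (hn : 0 < n) (h : k * (k - 1) / 2 ≤ n * (n - 1) / 2) :
    k ≤ n := by
  rw [← Nat.choose_two_right, ← Nat.choose_two_right] at h
  by_contra! hlt
  have h1 : (n + 1).choose 2 ≤ k.choose 2 := Nat.choose_le_choose 2 hlt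
  have h2 : (n + 1).choose 2 = n + n.choose 2 := by
    rw [Nat.choose_succ_succ' n 1, Nat.choose_one_right]
  omega

lemma sum_one_div_le_one_add_log (k : ℕ) :
    ∑ j ∈ Finset.Icc 1 k, (1 / (j : ℝ)) ≤ 1 + Real.log k := by
  have h := harmonic_le_one_add_log k
  rw [harmonic_eq_sum_Icc] at h
  push_cast at h
  simpa only [one_div] using h

/-- A fully connected network of `n` nodes with `ñ = O(n·log n)` jammers
placed according to the greedy approach (remaining links consolidated into a single
mini-FC of the largest possible size `k` with `k(k−1)/2 ≤ n(n−1)/2 − ñ`) still has average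
version age `O(log n)`. -/
theorem greedy_jammed_FC_age_nlogn
    (lamS lam : ℝ) (hlamS : 0 < lamS) (hlam : 0 < lam) (c : ℝ) (hc : 0 < c) :
    ∃ C : ℝ, 0 < C ∧ ∃ N : ℕ, 0 < N ∧ ∀ n : ℕ, N ≤ n →
      ∀ ntilde : ℕ, (ntilde : ℝ) ≤ c * (n : ℝ) * Real.log n →
      ∀ k : ℕ, 0 < k → k * (k - 1) / 2 ≤ n * (n - 1) / 2 - ntilde →
        (∀ k' : ℕ, 0 < k' → k' * (k' - 1) / 2 ≤ n * (n - 1) / 2 - ntilde → k' ≤ k) →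
        greedyAvgAge lamS lam n k ≤ C * (lamS / lam) * Real.log n := by
  refine ⟨3 + 2 * c, by positivity, 3, by norm_num, fun n hn m hm k hk hle hmax ↦ ?_⟩
  have hlog : 1 ≤ Real.log n := by
    rw [Real.le_log_iff_exp_le (by positivity)]
    have : (3 : ℝ) ≤ n := by exact_mod_cast hn
    linarith [Real.exp_one_lt_d9]
  have hkn : k ≤ n := le_of_links_le (by omega) (hle.trans (Nat.sub_le _ _))
  have hlogk : Real.log k ≤ Real.log n :=
    Real.log_le_log (by exact_mod_cast hk) (by exact_mod_cast hkn)
  have hlt : n * (n - 1) / 2 - m < (k + 1) * k / 2 := by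
    by_contra! h
    have := hmax (k + 1) k.succ_pos (by simpa using h)
    omega
  have hiso : (n : ℝ) - k ≤ 2 * (c * Real.log n) + 1 :=
    isolated_le_of_links_lt (by omega) (by positivity) (hm.trans_eq (by ring)) hlt
  have hsum := sum_one_div_le_one_add_log k
  calc greedyAvgAge lamS lam n k
      ≤ (lamS / lam) * ((3 + 2 * c) * Real.log n) :=
        mul_le_mul_of_nonneg_left (by linarith) (by positivity)
    _ = (3 + 2 * c) * (lamS / lam) * Real.log n := by ring
end

section
/- Fix reals λ_s > 0, λ > 0, a real α with 1 < α ≤ 2, and a real c > 0 (with c < 1/2 when α = 2), and define for positive integers n ≥ k ≥ 1 the greedy-configuration average age Δavg(n,k) = (λ_s/λ)·( Σ_{j=1}^{k} 1/j + (n − k) ). Then there exist a constant C > 0 and a positive integer N such that for all integers n ≥ N, taking ñ = ⌈c·n^α⌉ (which satisfies ñ ≤ n(n−1)/2 for n large) and k to be the largest positive integer with k·(k−1)/2 ≤ n·(n−1)/2 − ñ, one has Δavg(n,k) ≤ C·(λ_s/λ)·n^{α−1}. That is, a fully connected network of n nodes with ñ = ⌈c·n^α⌉ jammers placed according to the greedy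 approach has average version age O(n^{α−1}). -/
/-- The harmonic sum over `1 ≤ j ≤ k` with `k ≤ n` is at most a constant times `n ^ s`. -/
theorem sum_one_div_le_const_mul_rpow {n k : ℕ} (hk : 0 < k) (hkn : k ≤ n) {s : ℝ} (hs : 0 < s) :
    ∑ j ∈ Finset.Icc 1 k, (1 / (j : ℝ)) ≤ (1 + 1 / s) * (n : ℝ) ^ s := by
  have h1 : ∑ j ∈ Finset.Icc 1 k, (1 / (j : ℝ)) ≤ 1 + Real.log k := by
    have h := harmonic_le_one_add_log k
    rw [harmonic_eq_sum_Icc] at h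
    push_cast at h
    simpa only [one_div] using h
  have hk0 : (0 : ℝ) < k := by exact_mod_cast hk
  have hkn' : (k : ℝ) ≤ n := by exact_mod_cast hkn
  have hn1 : (1 : ℝ) ≤ n := by exact_mod_cast (show 1 ≤ n by omega)
  have h2 : Real.log k ≤ Real.log n := Real.log_le_log hk0 hkn'
  have h3 : Real.log n ≤ (n : ℝ) ^ s / s := Real.log_le_rpow_div (by linarith) hs
  have h4 : (1 : ℝ) ≤ (n : ℝ) ^ s := Real.one_le_rpow hn1 hs.le
  calc _ ≤ (n : ℝ) ^ s + (n : ℝ) ^ s / s := by linarith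
    _ = _ := by ring

/-- If a complete graph on `n` vertices with `m` edges removed has fewer edges than one on
`k + 1` vertices, then `k` satisfies `n (n - 1 - k) ≤ 2 m`. -/
theorem mul_sub_le_of_lt_triangle {n k m : ℕ}
    (h : n * (n - 1) / 2 - m < (k + 1) * k / 2) :
    (n : ℝ) * ((n : ℝ) - 1 - k) ≤ 2 * m := by
  have h1 : n * (n - 1) < (k + 1) * k + 2 * m := by
    have := Nat.div_mul_cancel (Nat.even_mul_pred_self n).two_dvd
    have := Nat.div_mul_cancel (Nat.even_mul_succ_self k).two_dvd
    have := mul_comm (k + 1) k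
    omega
  have h2 : n * n < (k + 1) * k + 2 * m + n := by
    have : n * (n - 1) + n = n * n := by cases n <;> simp; ring
    omega
  have h3 : (n : ℝ) * n < (k + 1) * k + 2 * m + n := by exact_mod_cast h2
  have hk : (0 : ℝ) ≤ k := k.cast_nonneg
  have hn : (0 : ℝ) ≤ n := n.cast_nonneg
  have hm : (0 : ℝ) ≤ m := m.cast_nonneg
  rcases le_total 0 ((n : ℝ) - 1 - k) with h0 | h0
  · nlinarith [mul_nonneg h0 hk]
  · nlinarith [mul_nonneg hn (neg_nonneg.2 h0)]

/-- A fully connected network of `n` nodes with `ñ = ⌈c·n^α⌉` jammers,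
`1 < α ≤ 2` (and `c < 1/2` when `α = 2`), placed according to the greedy approach
(remaining links consolidated into a single mini-FC of the largest possible size `k` with
`k(k−1)/2 ≤ n(n−1)/2 − ñ`) has average version age `O(n^{α−1})`. -/
theorem greedy_jammed_FC_age_nalpha
    (lamS lam : ℝ) (hlamS : 0 < lamS) (hlam : 0 < lam)
    (α : ℝ) (hα1 : 1 < α) (hα2 : α ≤ 2)
    (c : ℝ) (hc : 0 < c) (hc2 : α = 2 → c < 1 / 2) :
    ∃ C : ℝ, 0 < C ∧ ∃ N : ℕ, 0 < N ∧ ∀ n : ℕ, N ≤ n →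
      ∀ k : ℕ, 0 < k →
        k * (k - 1) / 2 ≤ n * (n - 1) / 2 - ⌈c * (n : ℝ) ^ α⌉₊ →
        (∀ k' : ℕ, 0 < k' →
          k' * (k' - 1) / 2 ≤ n * (n - 1) / 2 - ⌈c * (n : ℝ) ^ α⌉₊ → k' ≤ k) →
        greedyAvgAge lamS lam n k ≤ C * (lamS / lam) * (n : ℝ) ^ (α - 1) := by
  have hs : 0 < α - 1 := by linarith
  refine ⟨(1 + 1 / (α - 1)) + (2 * c + 3), by positivity, 1, one_pos, ?_⟩
  intro n hn k hk hfit hmax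
  have hkn : k ≤ n := by
    by_contra! hlt
    have h1 : (n + 1) * n ≤ k * (k - 1) := Nat.mul_le_mul hlt (by omega)
    have h2 : (n + 1) * n = n * (n - 1) + 2 * n := by
      obtain ⟨m, rfl⟩ := Nat.exists_eq_add_of_le' hn
      simp only [Nat.add_sub_cancel]
      ring
    omega
  have hlt : n * (n - 1) / 2 - ⌈c * (n : ℝ) ^ α⌉₊ < (k + 1) * k / 2 := by
    by_contra! hle
    have := hmax (k + 1) k.succ_pos (by simpa using hle)
    omega
  have hn1 : (1 : ℝ) ≤ n := by exact_mod_cast hn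
  have hpow : (n : ℝ) ^ α = n * (n : ℝ) ^ (α - 1) := by
    rw [Real.rpow_sub_one (by linarith)]
    field_simp
  have hceil : (⌈c * (n : ℝ) ^ α⌉₊ : ℝ) < c * (n : ℝ) ^ α + 1 :=
    Nat.ceil_lt_add_one (by positivity)
  have hone : (1 : ℝ) ≤ (n : ℝ) ^ (α - 1) := Real.one_le_rpow hn1 hs.le
  have hgap : (n : ℝ) - 1 - k ≤ 2 * c * (n : ℝ) ^ (α - 1) + 2 := by
    refine le_of_mul_le_mul_left ?_ (zero_lt_one.trans_le hn1)
    have := mul_sub_le_of_lt_triangle hlt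
    rw [hpow] at this hceil
    linarith
  have hsum := sum_one_div_le_const_mul_rpow hk hkn hs
  rw [greedyAvgAge, mul_comm _ (lamS / lam), mul_assoc]
  refine mul_le_mul_of_nonneg_left ?_ (by positivity)
  linarith
end
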